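/- arXiv:1704.00589 — 4 statements merged into one kernel-verified Lean document; each statement's English description precedes it below -/
import Mathlib

section
/- Let A be a Hopf algebra over ℂ with bijective antipode, let B ⊆ A be a Hopf subalgebra such that A is faithfully flat as a left B-module (via the inclusion), and suppose there exists a right A/B-integral t ∈ A with ε(t) ≠ 0. Then the projective dimension of the trivial right A-module ℂ_ε (ℂ with action λ·a = ε(a)λ) over A equals the projective dimension of the trivial right B-module ℂ_{ε|B} over B (as elements of ℕ ∪ {∞}). (This is the statement cd(A) = cd(B) of the paper, using that for a Hopf algebra the Hochschild cohomological dimension equals the projective dimension of the trivial module.) -/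
open MulOpposite

/-- `B⁺A`: the linear span of the products `b·a` with `b ∈ B`, `ε(b) = 0` and `a ∈ A`. -/
def BplusA {A : Type*} [Ring A] [HopfAlgebra ℂ A] (B : Subalgebra ℂ A) : Submodule ℂ A :=
  Submodule.span ℂ
    {x : A | ∃ b a : A, b ∈ B ∧ Coalgebra.counit (R := ℂ) b = 0 ∧ x = b * a}

/-- A Hopf subalgebra: a subalgebra `B ⊆ A` with `Δ(B)` contained in the image of
`B ⊗ B` in `A ⊗ A` and `S(B) ⊆ B`. -/
def IsHopfSubalgebra {A : Type*} [Ring A] [HopfAlgebra ℂ A] (B : Subalgebra ℂ A) : Prop :=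
  (∀ b ∈ B, Coalgebra.comul (R := ℂ) b ∈
      LinearMap.range (TensorProduct.map B.val.toLinearMap B.val.toLinearMap))
  ∧ ∀ b ∈ B, HopfAlgebra.antipode (R := ℂ) b ∈ B

/-- A right `A/B`-integral: an element `t ∈ A` with `ta − ε(a)t ∈ B⁺A` for all `a ∈ A`. -/
def IsRightRelIntegral {A : Type*} [Ring A] [HopfAlgebra ℂ A] (B : Subalgebra ℂ A)
    (t : A) : Prop :=
  ∀ a : A, t * a - Coalgebra.counit (R := ℂ) a • t ∈ BplusA B

/-- A left module `M` over a (possibly noncommutative) ring `R` is flat, expressed by the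
standard equational criterion: every relation `Σ rᵢ xᵢ = 0` comes from a matrix
factorization through relations in `R`. -/
def LeftFlat (R : Type*) [Ring R] (M : Type*) [AddCommGroup M] [Module R M] : Prop :=
  ∀ (k : ℕ) (r : Fin k → R) (x : Fin k → M), ∑ i, r i • x i = 0 →
    ∃ (m : ℕ) (c : Fin k → Fin m → R) (y : Fin m → M),
      (∀ i, x i = ∑ j, c i j • y j) ∧ ∀ j, ∑ i, r i * c i j = 0

/-- A left module `M` over a (possibly noncommutative) ring `R` is faithfully flat:
it is flat and `I·M ≠ M` for every proper right ideal `I` of `R`. -/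
def LeftFaithfullyFlat (R : Type*) [Ring R] (M : Type*) [AddCommGroup M] [Module R M] :
    Prop :=
  LeftFlat R M ∧ ∀ I : Submodule Rᵐᵒᵖ R, I ≠ ⊤ →
    AddSubgroup.closure {z : M | ∃ r ∈ I, ∃ x : M, z = r • x} ≠ ⊤

/-- `A` is finitely generated and projective as a right `B`-module, expressed through the
dual basis characterization: there are `x₁,…,x_k ∈ A` and right-`B`-linear functionals
`f₁,…,f_k : A → B` with `a = Σ xᵢ·fᵢ(a)` for all `a`. -/
def FGProjRight {A : Type*} [Ring A] [Algebra ℂ A] (B : Subalgebra ℂ A) : Prop :=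
  ∃ (k : ℕ) (x : Fin k → A) (f : Fin k → (A →ₗ[ℂ] ↥B)),
    (∀ (i : Fin k) (a : A) (b : ↥B), f i (a * ↑b) = f i a * b)
    ∧ ∀ a : A, a = ∑ i, x i * ↑(f i a)

/-- `A` is finitely generated and projective as a left `B`-module, expressed through the
dual basis characterization. -/
def FGProjLeft {A : Type*} [Ring A] [Algebra ℂ A] (B : Subalgebra ℂ A) : Prop :=
  ∃ (k : ℕ) (x : Fin k → A) (f : Fin k → (A →ₗ[ℂ] ↥B)),
    (∀ (i : Fin k) (b : ↥B) (a : A), f i (↑b * a) = b * f i a)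
    ∧ ∀ a : A, a = ∑ i, ↑(f i a) * x i


universe u

/-- `pdLE R n M` says that the projective dimension of the `R`-module `M` is at most `n`:
for `n = 0` it means `M` is projective, and for `n+1` it means the kernel of the canonical
surjection `(M →₀ R) → M` (the syzygy module) has projective dimension at most `n`.
By (generalized) Schanuel's lemma this agrees with the usual definition via projective
resolutions. -/
def pdLE (R : Type u) [Ring R] : ℕ → ∀ (M : Type u) [AddCommGroup M] [Module R M], Prop
  | 0, M, _, _ => Module.Projective R M
  | n + 1, M, _, _ =>
      pdLE R n ↥(LinearMap.ker (Finsupp.linearCombination R (_root_.id : M → M)))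

/-- The right `A`-module structure (i.e. left `Aᵐᵒᵖ`-module structure) on `ℂ` induced by
an algebra map `ε : A → ℂ`: the action is `a • λ = ε(a)λ`. -/
noncomputable def trivModOp (A : Type*) [Ring A] [Algebra ℂ A] (ε : A →ₐ[ℂ] ℂ) :
    Module Aᵐᵒᵖ ℂ :=
  Module.compHom ℂ (RingHom.fromOpposite ε.toRingHom fun _ _ => Commute.all _ _)

/-- `FPn R n M` says that the `R`-module `M` is of type `FP_n`: for `n = 0` it means `M`
is finitely generated, and for `n+1` it means there is a surjection from a finitely
generated free module whose kernel is of type `FP_n`. -/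
def FPn (R : Type u) [Ring R] : ℕ → ∀ (M : Type u) [AddCommGroup M] [Module R M], Prop
  | 0, M, _, _ => Module.Finite R M
  | n + 1, M, _, _ =>
      ∃ (k : ℕ) (f : (Fin k → R) →ₗ[R] M), Function.Surjective f ∧
        FPn R n ↥(LinearMap.ker f)

open CategoryTheory in
theorem hasProjectiveDimensionLE_succ_iff_ker {R : Type u} [Ring R] (n : ℕ)
    {P M : Type u} [AddCommGroup P] [Module R P] [AddCommGroup M] [Module R M]
    [Module.Projective R P] {f : P →ₗ[R] M} (hf : Function.Surjective f) :
    HasProjectiveDimensionLE (ModuleCat.of R M) (n + 1) ↔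
      HasProjectiveDimensionLE (ModuleCat.of R (LinearMap.ker f)) n :=
  (LinearMap.shortExact_shortComplexKer hf).hasProjectiveDimensionLT_X₃_iff n
    ((IsProjective.iff_projective P).1 inferInstance)

open CategoryTheory in
/-- `pdLE` agrees with Mathlib's bound on the projective dimension. -/
theorem pdLE_iff_hasProjectiveDimensionLE {R : Type u} [Ring R] (n : ℕ)
    (M : Type u) [AddCommGroup M] [Module R M] :
    pdLE R n M ↔ HasProjectiveDimensionLE (ModuleCat.of R M) n := by
  induction n generalizing M with
  | zero =>
    rw [← projective_iff_hasProjectiveDimensionLE_zero, ← IsProjective.iff_projective]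
    rfl
  | succ n ih =>
    exact (ih _).trans (hasProjectiveDimensionLE_succ_iff_ker n
      (Finsupp.linearCombination_id_surjective R M)).symm

theorem pdLE_succ_iff_ker {R : Type u} [Ring R] (n : ℕ)
    {P M : Type u} [AddCommGroup P] [Module R P] [AddCommGroup M] [Module R M]
    [Module.Projective R P] {f : P →ₗ[R] M} (hf : Function.Surjective f) :
    pdLE R (n + 1) M ↔ pdLE R n (LinearMap.ker f) := by
  simp only [pdLE_iff_hasProjectiveDimensionLE, hasProjectiveDimensionLE_succ_iff_ker n hf]

theorem Module.Projective.finsupp {R : Type*} [Ring R] (ι : Type*) (N : Type*) [AddCommGroup N]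
    [Module R N] [Module.Projective R N] : Module.Projective R (ι →₀ N) := by
  classical
  exact .of_equiv (finsuppLequivDFinsupp R (ι := ι) (M := N)).symm

/-- Projectivity is transitive along a ring extension that need not be central. -/
theorem Module.Projective.of_tower {R S : Type*} [Ring R] [Ring S] [Module R S]
    [IsScalarTower R S S] [Module.Projective R S] {M : Type*} [AddCommGroup M] [Module S M]
    [Module R M] [IsScalarTower R S M] [Module.Projective S M] : Module.Projective R M := by
  obtain ⟨s, hs⟩ := Module.projective_def'.1 (inferInstance : Module.Projective S M)
  have := Module.Projective.finsupp (R := R) M S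
  refine Module.Projective.of_split (M := M →₀ S) (s.restrictScalars R)
    ((Finsupp.linearCombination S _root_.id).restrictScalars R) ?_
  ext m
  exact LinearMap.congr_fun hs m

/-- If `S` is projective over `R`, and an `S`-module is projective as soon as it is so over `R`,
then projective dimensions over `S` can be computed over `R`. -/
theorem pdLE_iff_of_tower {R S : Type u} [Ring R] [Ring S] [Module R S]
    [IsScalarTower R S S] [Module.Projective R S]
    (h : ∀ (M : Type u) [AddCommGroup M] [Module S M] [Module R M] [IsScalarTower R S M],
      Module.Projective R M → Module.Projective S M)
    (n : ℕ) (M : Type u) [AddCommGroup M] [Module S M] [Module R M] [IsScalarTower R S M] :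
    pdLE S n M ↔ pdLE R n M := by
  induction n generalizing M with
  | zero => exact ⟨fun (_ : Module.Projective S M) ↦ Module.Projective.of_tower (S := S), h M⟩
  | succ n ih =>
    have := Module.Projective.finsupp (R := R) M S
    have hf := Finsupp.linearCombination_id_surjective S M
    have : IsScalarTower R S (LinearMap.ker (Finsupp.linearCombination S (_root_.id : M → M))) :=
      ⟨fun r s x ↦ Subtype.ext (smul_assoc r s x.1)⟩
    exact (ih (LinearMap.ker (Finsupp.linearCombination S (_root_.id : M → M)))).trans
      (pdLE_succ_iff_ker (R := R) n
        (f := (Finsupp.linearCombination S (_root_.id : M → M)).restrictScalars R) hf).symm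

section Flat

/-- In a flat module a finite family satisfying finitely many linear relations factors through a
family for which the relations hold at the level of coefficients. -/
theorem LeftFlat.exists_factorization {R M : Type*} [Ring R] [AddCommGroup M] [Module R M]
    (h : LeftFlat R M) {ι σ : Type*} [Fintype ι] [Finite σ] (x : ι → M) (ρ : σ → ι → R)
    (hρ : ∀ s, ∑ i, ρ s i • x i = 0) :
    ∃ (m : ℕ) (c : ι → Fin m → R) (y : Fin m → M),
      (∀ i, x i = ∑ j, c i j • y j) ∧ ∀ s j, ∑ i, ρ s i * c i j = 0 := by
  let e := (Fintype.equivFin ι).symm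
  suffices H : ∀ t : Finset σ, ∃ (m : ℕ) (c : ι → Fin m → R) (y : Fin m → M),
      (∀ i, x i = ∑ j, c i j • y j) ∧ ∀ s ∈ t, ∀ j, ∑ i, ρ s i * c i j = 0 by
    cases nonempty_fintype σ
    simpa using H Finset.univ
  intro t
  induction t using Finset.cons_induction with
  | empty =>
    classical
    refine ⟨_, fun i j ↦ if e j = i then 1 else 0, x ∘ e, fun i ↦ ?_, by simp⟩
    simp [e.sum_comp (fun k ↦ if k = i then x k else 0)]
  | cons s t _ ih =>
    obtain ⟨m, c, y, hx, hc⟩ := ih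
    obtain ⟨m', c', y', hy, hc'⟩ := h m (fun j ↦ ∑ i, ρ s i * c i j) y (by
      rw [← hρ s]
      simp_rw [hx, Finset.sum_smul, Finset.smul_sum, mul_smul]
      exact Finset.sum_comm)
    refine ⟨m', fun i l ↦ ∑ j, c i j * c' j l, y', fun i ↦ ?_, fun s' hs' l ↦ ?_⟩
    · rw [hx i]
      simp_rw [Finset.sum_smul, mul_smul]
      rw [Finset.sum_comm]
      exact Finset.sum_congr rfl fun j _ ↦ by rw [hy j, Finset.smul_sum]
    · have key : ∀ r : ι → R, ∑ i, r i * ∑ j, c i j * c' j l =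
          ∑ j, (∑ i, r i * c i j) * c' j l := fun r ↦ by
        simp_rw [Finset.mul_sum, Finset.sum_mul, mul_assoc]
        exact Finset.sum_comm
      rw [key]
      rcases Finset.mem_cons.1 hs' with rfl | hs'
      · exact hc' l
      · simp [hc s' hs']

end Flat

open scoped TensorProduct

section Balanced

variable {A : Type*} [Ring A] [Algebra ℂ A]

/-- The kernel of the canonical map `A ⊗ A → (A / N) ⊗_B A`, for a right `B`-submodule `N` of
`A`. -/
def balancedRel (B : Subalgebra ℂ A) (N : Submodule ℂ A) : Submodule ℂ (A ⊗[ℂ] A) :=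
  Submodule.span ℂ ({w | ∃ x y : A, ∃ b ∈ B, w = (x * b) ⊗ₜ y - x ⊗ₜ (b * y)} ∪
    {w | ∃ n ∈ N, ∃ y, w = n ⊗ₜ y})

variable {B : Subalgebra ℂ A} {N : Submodule ℂ A}

theorem tmul_sub_tmul_mem_balancedRel (x y : A) {b : A} (hb : b ∈ B) :
    (x * b) ⊗ₜ y - x ⊗ₜ[ℂ] (b * y) ∈ balancedRel B N :=
  Submodule.subset_span (.inl ⟨x, y, b, hb, rfl⟩)

theorem tmul_mem_balancedRel {n : A} (hn : n ∈ N) (y : A) :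
    n ⊗ₜ[ℂ] y ∈ balancedRel B N :=
  Submodule.subset_span (.inr ⟨n, hn, y, rfl⟩)

theorem balancedRel_mono {N' : Submodule ℂ A} (h : N ≤ N') :
    balancedRel B N ≤ balancedRel B N' :=
  Submodule.span_mono (Set.union_subset_union_right _ fun _ ⟨n, hn, y, e⟩ ↦ ⟨n, h hn, y, e⟩)

theorem exists_sum_eq_of_mem_balancedRel {w : A ⊗[ℂ] A} (hw : w ∈ balancedRel B N) :
    ∃ (κ : Type) (_ : Fintype κ) (x y n z : κ → A) (b : κ → B), (∀ l, n l ∈ N) ∧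
      w = ∑ l, ((x l * b l) ⊗ₜ y l - x l ⊗ₜ[ℂ] (b l * y l) + n l ⊗ₜ z l) := by
  induction hw using Submodule.span_induction with
  | mem w hw =>
    rcases hw with ⟨x, y, b, hb, rfl⟩ | ⟨n, hn, y, rfl⟩
    · exact ⟨Unit, inferInstance, fun _ ↦ x, fun _ ↦ y, 0, 0, fun _ ↦ ⟨b, hb⟩, by simp, by simp⟩
    · exact ⟨Unit, inferInstance, 0, 0, fun _ ↦ n, fun _ ↦ y, 0, fun _ ↦ hn, by simp⟩
  | zero => exact ⟨Empty, inferInstance, 0, 0, 0, 0, 0, by simp, by simp⟩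
  | add w w' _ _ ih ih' =>
    obtain ⟨κ, _, x, y, n, z, b, hn, rfl⟩ := ih
    obtain ⟨κ', _, x', y', n', z', b', hn', rfl⟩ := ih'
    exact ⟨κ ⊕ κ', inferInstance, Sum.elim x x', Sum.elim y y', Sum.elim n n', Sum.elim z z',
      Sum.elim b b', by rintro (l | l) <;> simp [hn, hn'], by simp⟩
  | smul r w _ ih =>
    obtain ⟨κ, _, x, y, n, z, b, hn, rfl⟩ := ih
    refine ⟨κ, inferInstance, r • x, y, r • n, z, b, fun l ↦ N.smul_mem r (hn l), ?_⟩
    simp [Finset.smul_sum, smul_add, smul_sub, TensorProduct.smul_tmul']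

/-- The equational criterion for the vanishing of an element of `(A / N) ⊗_B A` when `A` is flat
as a left `B`-module. -/
theorem LeftFlat.exists_of_sum_tmul_mem (h : LeftFlat B A)
    (hN : ∀ n ∈ N, ∀ b ∈ B, n * b ∈ N) {ι : Type*} [Fintype ι] (q a : ι → A)
    (hqa : ∑ i, q i ⊗ₜ[ℂ] a i ∈ balancedRel B N) :
    ∃ (m : ℕ) (c : ι → Fin m → B) (y : Fin m → A),
      (∀ i, a i = ∑ j, c i j • y j) ∧ ∀ j, ∑ i, q i * c i j ∈ N := by
  obtain ⟨κ, _, x, y, n, z, b, hn, hw⟩ := exists_sum_eq_of_mem_balancedRel hqa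
  let lft : ι ⊕ κ ⊕ κ ⊕ κ → A := Sum.elim q (Sum.elim (fun l ↦ -(x l * b l)) (Sum.elim x (-n)))
  let rgt : ι ⊕ κ ⊕ κ ⊕ κ → A := Sum.elim a (Sum.elim y (Sum.elim (fun l ↦ b l * y l) z))
  have h0 : ∑ i, rgt i ⊗ₜ[ℂ] lft i = 0 := by
    apply (TensorProduct.comm ℂ A A).injective
    simp only [Fintype.sum_sum_type, Sum.elim_inl, Sum.elim_inr, lft, rgt, map_add, map_sum,
      TensorProduct.comm_tmul, map_zero, Pi.neg_apply]
    simp only [hw, Finset.sum_add_distrib, Finset.sum_sub_distrib, TensorProduct.neg_tmul,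
      Finset.sum_neg_distrib]
    abel
  obtain ⟨k, r, e, hl, hr⟩ :=
    TensorProduct.vanishesTrivially_of_sum_tmul_eq_zero_of_rTensor_injective ℂ
      (Module.Flat.rTensor_preserves_injective_linearMap _ (Submodule.subtype_injective _)) h0
  let ρ : Fin k → ι ⊕ κ ⊕ κ → B := fun s ↦ Sum.elim (fun i ↦ r (.inl i) s • 1)
    (Sum.elim (fun l ↦ r (.inr (.inl l)) s • 1 + r (.inr (.inr (.inl l))) s • b l)
      (fun l ↦ r (.inr (.inr (.inr l))) s • 1))
  let C : (ι ⊕ κ ⊕ κ → A) → ι ⊕ κ ⊕ κ ⊕ κ → A := fun v ↦ Sum.elim (v ∘ .inl)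
    (Sum.elim (v ∘ .inr ∘ .inl) (Sum.elim (fun l ↦ b l * v (.inr (.inl l))) (v ∘ .inr ∘ .inr)))
  have hρ : ∀ s v, ∑ i, (ρ s i : A) * v i = ∑ i, r i s • C v i := fun s v ↦ by
    simp [ρ, C, Fintype.sum_sum_type, add_mul, Finset.sum_add_distrib, add_assoc]
  obtain ⟨m, c, u, hc, hρc⟩ := h.exists_factorization (Sum.elim a (Sum.elim y z)) ρ (fun s ↦ by
    simp only [Subalgebra.smul_def, smul_eq_mul]
    rw [hρ, ← hr s]
    exact Finset.sum_congr rfl fun i _ ↦ by rcases i with i | i | i | i <;> rfl)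
  refine ⟨m, fun i ↦ c (.inl i), u, fun i ↦ hc (.inl i), fun j ↦ ?_⟩
  have key : ∑ i, q i * c (.inl i) j = ∑ l, n l * c (.inr (.inr l)) j := by
    have h1 : ∀ s, ∑ i, r i s • C (fun i ↦ c i j) i = 0 := fun s ↦ by
      rw [← hρ]
      exact_mod_cast congrArg (Subtype.val : B → A) (hρc s j)
    have h2 : ∑ i, lft i * C (fun i ↦ c i j) i = 0 := by
      simp_rw [hl, Finset.sum_mul]
      rw [Finset.sum_comm]
      refine Finset.sum_eq_zero fun s _ ↦ ?_
      simp_rw [smul_mul_assoc, ← mul_smul_comm]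
      rw [← Finset.mul_sum, h1, mul_zero]
    simp only [lft, C, Fintype.sum_sum_type, Sum.elim_inl, Sum.elim_inr, Function.comp_apply,
      Pi.neg_apply, neg_mul, Finset.sum_neg_distrib, mul_assoc, neg_add_cancel_left] at h2
    rwa [add_neg_eq_zero] at h2
  rw [key]
  exact N.sum_mem fun l _ ↦ hN _ (hn l) _ (c _ j).2

/-- If `A` is faithfully flat as a left `B`-module, the map `A / N → (A / N) ⊗_B A` is
injective. -/
theorem LeftFaithfullyFlat.mem_of_tmul_one_mem (h : LeftFaithfullyFlat B A)
    (hN : ∀ n ∈ N, ∀ b ∈ B, n * b ∈ N) {q : A} (hq : q ⊗ₜ[ℂ] 1 ∈ balancedRel B N) : q ∈ N := by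
  obtain ⟨m, c, y, h1, hc⟩ := h.1.exists_of_sum_tmul_mem hN (fun _ : Unit ↦ q) (fun _ ↦ 1)
    (by simpa using hq)
  by_contra hqN
  let J : Submodule (↥B)ᵐᵒᵖ B :=
    { carrier := {b | q * b ∈ N}
      zero_mem' := by simp
      add_mem' := fun {b b'} hb hb' ↦ by simpa [mul_add] using N.add_mem hb hb'
      smul_mem' := fun b' b hb ↦ by simpa [mul_assoc] using hN _ hb _ b'.unop.2 }
  refine h.2 J (fun hJ ↦ hqN ?_) (top_unique fun a _ ↦ ?_)
  · have : (1 : B) ∈ J := hJ ▸ Submodule.mem_top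
    simpa [J] using this
  · rw [← one_mul a, h1 (), Finset.sum_mul]
    exact sum_mem fun j _ ↦ AddSubgroup.subset_closure
      ⟨c () j, by simpa [J] using hc j, y j * a, by rw [smul_mul_assoc]⟩

end Balanced

section HopfIdentities

open Coalgebra HopfAlgebra WithConv Algebra.TensorProduct

/-- The linear map `x ⊗ y ↦ (x ⊗ 1) * k * (1 ⊗ y)`. -/
noncomputable def outerMul {A : Type*} [Ring A] [Algebra ℂ A] (k : A ⊗[ℂ] A) :
    A ⊗[ℂ] A →ₗ[ℂ] A ⊗[ℂ] A :=
  LinearMap.mul' ℂ (A ⊗[ℂ] A) ∘ₗ TensorProduct.map (includeLeft (S := ℂ)).toLinearMap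
    (LinearMap.mulLeft ℂ k ∘ₗ includeRight.toLinearMap)

theorem outerMul_tmul {A : Type*} [Ring A] [Algebra ℂ A] (k : A ⊗[ℂ] A) (x y : A) :
    outerMul k (x ⊗ₜ y) = (x ⊗ₜ 1) * (k * (1 ⊗ₜ y)) := rfl

theorem outerMul_tmul_tmul {A : Type*} [Ring A] [Algebra ℂ A] (x y x' y' : A) :
    outerMul (x' ⊗ₜ y') (x ⊗ₜ y) = (x * x') ⊗ₜ[ℂ] (y' * y) := by
  simp [outerMul_tmul]

theorem outerMul_add {A : Type*} [Ring A] [Algebra ℂ A] (k k' w : A ⊗[ℂ] A) :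
    outerMul (k + k') w = outerMul k w + outerMul k' w := by
  induction w using TensorProduct.induction_on with
  | zero => simp
  | add w w' h h' => rw [map_add, h, h', map_add, map_add]; abel
  | tmul x y => simp only [outerMul_tmul, add_mul, mul_add]

theorem zero_outerMul {A : Type*} [Ring A] [Algebra ℂ A] (w : A ⊗[ℂ] A) :
    outerMul 0 w = 0 := by
  simpa using outerMul_add 0 0 w

variable {A : Type*} [Ring A] [HopfAlgebra ℂ A]

/-- The linear map `a ↦ S(a₁) ⊗ a₂`. -/
noncomputable def antipodeComul (A : Type*) [Ring A] [HopfAlgebra ℂ A] : A →ₗ[ℂ] A ⊗[ℂ] A :=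
  (antipode ℂ).rTensor A ∘ₗ comul

/-- The linear map `a ↦ a₁ ⊗ S(a₂)`. -/
noncomputable def comulAntipode (A : Type*) [Ring A] [HopfAlgebra ℂ A] : A →ₗ[ℂ] A ⊗[ℂ] A :=
  (antipode ℂ).lTensor A ∘ₗ comul

theorem antipodeComul_mul (x y : A) :
    antipodeComul A (x * y) = outerMul (antipodeComul A x) (antipodeComul A y) := by
  simp only [antipodeComul, LinearMap.comp_apply, Bialgebra.comul_mul]
  generalize comul (R := ℂ) x = v
  generalize comul (R := ℂ) y = w
  induction v using TensorProduct.induction_on with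
  | zero => simp [zero_outerMul]
  | add v v' h h' => simp only [add_mul, map_add, h, h', outerMul_add]
  | tmul x x' =>
    induction w using TensorProduct.induction_on with
    | zero => simp
    | add w w' h h' => simp only [mul_add, map_add, h, h']
    | tmul y y' => simp [outerMul_tmul_tmul, antipode_mul_antidistrib]

theorem comulAntipode_mul (x y : A) :
    comulAntipode A (x * y) = outerMul (comulAntipode A y) (comulAntipode A x) := by
  simp only [comulAntipode, LinearMap.comp_apply, Bialgebra.comul_mul]
  generalize comul (R := ℂ) x = v
  generalize comul (R := ℂ) y = w
  induction w using TensorProduct.induction_on with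
  | zero => simp [zero_outerMul]
  | add w w' h h' => simp only [mul_add, map_add, h, h', outerMul_add]
  | tmul y y' =>
    induction v using TensorProduct.induction_on with
    | zero => simp
    | add v v' h h' => simp only [add_mul, map_add, h, h']
    | tmul x x' => simp [outerMul_tmul_tmul, antipode_mul_antidistrib]

theorem algHom_conv_antipode {E : Type*} [Ring E] [Algebra ℂ E] (f : A →ₐ[ℂ] E) :
    toConv f.toLinearMap * toConv (f.toLinearMap ∘ₗ antipode ℂ) = 1 := by
  have := LinearMap.algHom_comp_convMul_distrib f (toConv .id) (toConv (antipode ℂ (A := A)))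
  rw [LinearMap.id_mul_antipode] at this
  apply WithConv.ext
  rw [ofConv_toConv, ofConv_toConv, LinearMap.comp_id] at this
  rw [← this]
  ext
  simp

theorem antipode_conv_algHom {E : Type*} [Ring E] [Algebra ℂ E] (f : A →ₐ[ℂ] E) :
    toConv (f.toLinearMap ∘ₗ antipode ℂ) * toConv f.toLinearMap = 1 := by
  have := LinearMap.algHom_comp_convMul_distrib f (toConv (antipode ℂ (A := A))) (toConv .id)
  rw [LinearMap.antipode_mul_id] at this
  apply WithConv.ext
  rw [ofConv_toConv, ofConv_toConv, LinearMap.comp_id] at this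
  rw [← this]
  ext
  simp

theorem sum_tmul_mul_antipodeComul {ι : Type*} {a : A} (r : Repr ℂ a ι) (x : A) :
    ∑ i ∈ r.index, (r.left i ⊗ₜ 1) * antipodeComul A (x * r.right i) =
      antipodeComul A x * (1 ⊗ₜ a) := by
  have h : toConv (antipodeComul A ∘ₗ LinearMap.mulLeft ℂ x) =
      toConv ((includeLeft (S := ℂ)).toLinearMap ∘ₗ antipode ℂ (A := A)) *
        toConv (LinearMap.mulLeft ℂ (antipodeComul A x) ∘ₗ includeRight.toLinearMap) := by
    ext y
    simp only [LinearMap.comp_apply, LinearMap.mulLeft_apply, antipodeComul_mul,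
      LinearMap.convMul_apply]
    generalize antipodeComul A x = k
    simp only [antipodeComul, outerMul, LinearMap.comp_apply, LinearMap.rTensor]
    rw [TensorProduct.map_map, LinearMap.comp_id]
  have := congrArg
    (fun f ↦ (toConv (includeLeft (S := ℂ) (B := A)).toLinearMap * f).ofConv a) h
  simp only [← mul_assoc, algHom_conv_antipode, one_mul] at this
  rw [r.convMul_apply] at this
  exact this

theorem toConv_comul_eq : toConv (comul (R := ℂ) (A := A)) =
    toConv (includeLeft (S := ℂ)).toLinearMap * toConv includeRight.toLinearMap := by
  ext y
  simp only [LinearMap.convMul_apply]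
  generalize comul (R := ℂ) y = v
  induction v using TensorProduct.induction_on with
  | zero => simp
  | add v v' h h' => simp only [map_add, ← h, ← h']
  | tmul x x' => simp

theorem sum_comul_mul_tmul_antipode {ι : Type*} {a : A} (r : Repr ℂ a ι) :
    ∑ i ∈ r.index, comul (R := ℂ) (r.left i) * (1 ⊗ₜ antipode ℂ (r.right i)) = a ⊗ₜ 1 := by
  have := congrArg
    (fun f : WithConv (A →ₗ[ℂ] A ⊗[ℂ] A) ↦
      (f * toConv (includeRight.toLinearMap ∘ₗ antipode ℂ)).ofConv a)
    (toConv_comul_eq (A := A))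
  simp only [mul_assoc, algHom_conv_antipode, mul_one] at this
  rw [r.convMul_apply] at this
  exact this

theorem sum_comulAntipode_mul_tmul {ι : Type*} {a : A} (r : Repr ℂ a ι) :
    ∑ i ∈ r.index, comulAntipode A (r.left i) * (1 ⊗ₜ r.right i) = a ⊗ₜ 1 := by
  have h : toConv (comulAntipode A) = toConv (includeLeft (S := ℂ)).toLinearMap *
      toConv (includeRight.toLinearMap ∘ₗ antipode ℂ) := by
    ext y
    simp only [LinearMap.convMul_apply, comulAntipode, LinearMap.comp_apply]
    generalize comul (R := ℂ) y = v
    induction v using TensorProduct.induction_on with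
    | zero => simp
    | add v v' h h' => simp only [map_add, ← h, ← h']
    | tmul x x' => simp
  have := congrArg
    (fun f ↦ (f * toConv includeRight.toLinearMap).ofConv a) h
  simp only [mul_assoc, antipode_conv_algHom, mul_one] at this
  rw [r.convMul_apply] at this
  exact this

end HopfIdentities

section HopfSubalgebra

open Coalgebra HopfAlgebra

theorem outerMul_mem_balancedRel {A : Type*} [Ring A] [Algebra ℂ A] {B : Subalgebra ℂ A}
    {w : A ⊗[ℂ] A} (hw : w ∈ balancedRel B ⊥) (v : A ⊗[ℂ] A) :
    outerMul w v ∈ balancedRel B ⊥ := by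
  induction v using TensorProduct.induction_on with
  | zero => simp
  | add v v' h h' => simpa using add_mem h h'
  | tmul a a' =>
    change w ∈ (balancedRel B ⊥).comap
      (LinearMap.mulLeft ℂ (a ⊗ₜ 1) ∘ₗ LinearMap.mulRight ℂ (1 ⊗ₜ a'))
    refine Submodule.span_le.2 ?_ hw
    rintro _ (⟨x, y, b, hb, rfl⟩ | ⟨n, hn, y, rfl⟩)
    · simpa [mul_sub, sub_mul, mul_assoc] using
        tmul_sub_tmul_mem_balancedRel (N := ⊥) (a * x) (y * a') hb
    · simp [(Submodule.mem_bot _).1 hn]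

theorem mul_one_tmul_mem_balancedRel {A : Type*} [Ring A] [Algebra ℂ A] {B : Subalgebra ℂ A}
    {N : Submodule ℂ A} {w : A ⊗[ℂ] A} (hw : w ∈ balancedRel B N) (a : A) :
    w * (1 ⊗ₜ a) ∈ balancedRel B N := by
  rw [← LinearMap.mulRight_apply ℂ, ← Submodule.mem_comap]
  refine Submodule.span_le.2 ?_ hw
  rintro _ (⟨x, y, b, hb, rfl⟩ | ⟨n, hn, y, rfl⟩)
  · simpa [sub_mul, mul_assoc] using tmul_sub_tmul_mem_balancedRel x (y * a) hb
  · simpa using tmul_mem_balancedRel hn (y * a)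

theorem mul'_tmul_one_sub_mem_balancedRel {A : Type*} [Ring A] [Algebra ℂ A]
    {B : Subalgebra ℂ A} {N : Submodule ℂ A} (f : B →ₗ[ℂ] A) (g : B →ₗ[ℂ] B) (w : B ⊗[ℂ] B) :
    (LinearMap.mul' ℂ A (TensorProduct.map f (B.val.toLinearMap ∘ₗ g) w)) ⊗ₜ 1 -
      TensorProduct.map f (B.val.toLinearMap ∘ₗ g) w ∈ balancedRel B N := by
  induction w using TensorProduct.induction_on with
  | zero => simp
  | add v v' h h' =>
    simpa only [map_add, TensorProduct.add_tmul, add_sub_add_comm] using add_mem h h'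
  | tmul x y =>
    simpa using tmul_sub_tmul_mem_balancedRel (f x) 1 (g y).2

variable {A : Type*} [Ring A] [HopfAlgebra ℂ A] {B : Subalgebra ℂ A}

theorem IsHopfSubalgebra.antipodeComul_sub_mem (hB : IsHopfSubalgebra B) {N : Submodule ℂ A}
    {b : A} (hb : b ∈ B) : antipodeComul A b - counit (R := ℂ) b • 1 ∈ balancedRel B N := by
  obtain ⟨w, hw⟩ := hB.1 b hb
  have h := mul'_tmul_one_sub_mem_balancedRel (N := N) (antipode ℂ ∘ₗ B.val.toLinearMap) .id w
  have h1 : TensorProduct.map (antipode ℂ ∘ₗ B.val.toLinearMap) (B.val.toLinearMap ∘ₗ .id) w =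
      antipodeComul A b := by
    rw [antipodeComul, LinearMap.comp_apply, ← hw, LinearMap.rTensor, TensorProduct.map_map]
    rfl
  rw [h1, antipodeComul, LinearMap.comp_apply, mul_antipode_rTensor_comul_apply,
    Algebra.algebraMap_eq_smul_one, ← TensorProduct.smul_tmul'] at h
  rw [← neg_mem_iff, neg_sub]
  exact h

theorem IsHopfSubalgebra.comulAntipode_sub_mem (hB : IsHopfSubalgebra B) {N : Submodule ℂ A}
    {b : A} (hb : b ∈ B) : comulAntipode A b - counit (R := ℂ) b • 1 ∈ balancedRel B N := by
  obtain ⟨w, hw⟩ := hB.1 b hb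
  have h := mul'_tmul_one_sub_mem_balancedRel (N := N) B.val.toLinearMap
    ((antipode ℂ).restrict (p := B.toSubmodule) (q := B.toSubmodule) hB.2) w
  have h1 : TensorProduct.map B.val.toLinearMap (B.val.toLinearMap ∘ₗ
      (antipode ℂ).restrict (p := B.toSubmodule) (q := B.toSubmodule) hB.2) w =
      comulAntipode A b := by
    rw [comulAntipode, LinearMap.comp_apply, ← hw, LinearMap.lTensor, TensorProduct.map_map]
    rfl
  rw [h1, comulAntipode, LinearMap.comp_apply, mul_antipode_lTensor_comul_apply,
    Algebra.algebraMap_eq_smul_one, ← TensorProduct.smul_tmul'] at h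
  rw [← neg_mem_iff, neg_sub]
  exact h

theorem outerMul_one (w : A ⊗[ℂ] A) : outerMul 1 w = w := by
  induction w using TensorProduct.induction_on with
  | zero => simp
  | add v v' h h' => simp [h, h']
  | tmul x y => simp [outerMul_tmul]

theorem smul_outerMul (r : ℂ) (k w : A ⊗[ℂ] A) : outerMul (r • k) w = r • outerMul k w := by
  induction w using TensorProduct.induction_on with
  | zero => simp
  | add v v' h h' => simp [h, h']
  | tmul x y => simp [outerMul_tmul]

theorem IsHopfSubalgebra.antipodeComul_mul_sub_mem (hB : IsHopfSubalgebra B) {b : A} (hb : b ∈ B)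
    (a : A) : antipodeComul A (b * a) - counit (R := ℂ) b • antipodeComul A a ∈
      balancedRel B ⊥ := by
  have h := outerMul_mem_balancedRel (hB.antipodeComul_sub_mem (N := ⊥) hb) (antipodeComul A a)
  rwa [sub_eq_add_neg, ← neg_smul, outerMul_add, smul_outerMul, outerMul_one, neg_smul,
    ← antipodeComul_mul, ← sub_eq_add_neg] at h

theorem IsHopfSubalgebra.comulAntipode_mul_sub_mem (hB : IsHopfSubalgebra B) {b : A} (hb : b ∈ B)
    (a : A) : comulAntipode A (a * b) - counit (R := ℂ) b • comulAntipode A a ∈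
      balancedRel B ⊥ := by
  have h := outerMul_mem_balancedRel (hB.comulAntipode_sub_mem (N := ⊥) hb) (comulAntipode A a)
  rwa [sub_eq_add_neg, ← neg_smul, outerMul_add, smul_outerMul, outerMul_one, neg_smul,
    ← comulAntipode_mul, ← sub_eq_add_neg] at h

/-- `AB⁺`: the linear span of the products `a·b` with `b ∈ B`, `ε(b) = 0` and `a ∈ A`. -/
def mulBplus (B : Subalgebra ℂ A) : Submodule ℂ A :=
  Submodule.span ℂ {x : A | ∃ a b : A, b ∈ B ∧ counit (R := ℂ) b = 0 ∧ x = a * b}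

theorem IsHopfSubalgebra.antipodeComul_mem (hB : IsHopfSubalgebra B) {a : A}
    (ha : a ∈ BplusA B) : antipodeComul A a ∈ balancedRel B ⊥ := by
  rw [← Submodule.mem_comap]
  refine Submodule.span_le.2 ?_ ha
  rintro _ ⟨b, a, hb, h0, rfl⟩
  simpa [h0] using hB.antipodeComul_mul_sub_mem hb a

theorem IsHopfSubalgebra.comulAntipode_mem (hB : IsHopfSubalgebra B) {a : A}
    (ha : a ∈ mulBplus B) : comulAntipode A a ∈ balancedRel B ⊥ := by
  rw [← Submodule.mem_comap]
  refine Submodule.span_le.2 ?_ ha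
  rintro _ ⟨a, b, hb, h0, rfl⟩
  simpa [h0] using hB.comulAntipode_mul_sub_mem hb a

end HopfSubalgebra

section Finiteness

open Coalgebra HopfAlgebra

theorem exists_dual_sum_smul_eq {K V ι : Type*} [Field K] [AddCommGroup V] [Module K V]
    [Finite ι] (v : ι → V) : ∃ (n : ℕ) (e : Fin n → V) (g : Fin n → Module.Dual K V),
      ∀ i, v i = ∑ k, g k (v i) • e k := by
  let W := Submodule.span K (Set.range v)
  have : Module.Finite K W := Module.Finite.span_of_finite K (Set.finite_range v)
  let b := Module.finBasis K W
  choose g hg using fun k ↦ (b.coord k).exists_extend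
  refine ⟨_, fun k ↦ b k, g, fun i ↦ ?_⟩
  have hi : v i ∈ W := Submodule.subset_span ⟨i, rfl⟩
  conv_lhs => rw [show v i = (⟨v i, hi⟩ : W).1 from rfl, ← b.sum_repr ⟨v i, hi⟩]
  simp only [Submodule.coe_sum, Submodule.coe_smul]
  refine Finset.sum_congr rfl fun k _ ↦ ?_
  rw [← b.coord_apply, ← hg]
  rfl

/-- The map `x ⊗ y ↦ f(y) x`. -/
noncomputable def sliceRight {A : Type*} [Ring A] [Algebra ℂ A] (f : Module.Dual ℂ A) :
    A ⊗[ℂ] A →ₗ[ℂ] A :=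
  TensorProduct.rid ℂ A ∘ₗ f.lTensor A

theorem sliceRight_tmul {A : Type*} [Ring A] [Algebra ℂ A] (f : Module.Dual ℂ A) (x y : A) :
    sliceRight f (x ⊗ₜ y) = f y • x := by
  simp [sliceRight]

variable {A : Type*} [Ring A] [HopfAlgebra ℂ A] {B : Subalgebra ℂ A}

theorem mul_mem_BplusA {h : A} (hh : h ∈ BplusA B) (a : A) : h * a ∈ BplusA B := by
  change h ∈ (BplusA B).comap (LinearMap.mulRight ℂ a)
  refine Submodule.span_le.2 ?_ hh
  rintro _ ⟨b, x, hb, h0, rfl⟩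
  exact Submodule.subset_span ⟨b, x * a, hb, h0, by simp [mul_assoc]⟩

theorem counit_eq_zero_of_mem_BplusA {h : A} (hh : h ∈ BplusA B) : counit (R := ℂ) h = 0 := by
  change h ∈ LinearMap.ker (counit (R := ℂ) (A := A))
  refine Submodule.span_le.2 ?_ hh
  rintro _ ⟨b, x, hb, h0, rfl⟩
  simp [h0]

theorem sub_counit_smul_one_mem {b : A} (hb : b ∈ B) :
    b - counit (R := ℂ) b • 1 ∈ BplusA B :=
  Submodule.subset_span ⟨b - counit (R := ℂ) b • 1, 1,
    sub_mem hb (B.smul_mem (one_mem B) _), by simp, by simp⟩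

theorem apply_mul_of_mem_dualAnnihilator {f : Module.Dual ℂ A}
    (hf : f ∈ (BplusA B).dualAnnihilator) {b : A} (hb : b ∈ B) (a : A) :
    f (b * a) = counit (R := ℂ) b * f a := by
  have := (Submodule.mem_dualAnnihilator f).1 hf _
    (mul_mem_BplusA (sub_counit_smul_one_mem (B := B) hb) a)
  rw [sub_mul, map_sub, smul_mul_assoc, one_mul, map_smul, sub_eq_zero] at this
  exact this

theorem IsHopfSubalgebra.sliceRight_comul_mul (hB : IsHopfSubalgebra B) {f : Module.Dual ℂ A}
    (hf : f ∈ (BplusA B).dualAnnihilator) {b : A} (hb : b ∈ B) (v : A ⊗[ℂ] A) :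
    sliceRight f (comul b * v) = b * sliceRight f v := by
  obtain ⟨w, hw⟩ := hB.1 b hb
  have hb' : b = sliceRight counit (comul (R := ℂ) b) := by
    simp [sliceRight, lTensor_counit_comul]
  conv_rhs => rw [hb']
  rw [← hw]
  clear hb' hw
  induction w using TensorProduct.induction_on with
  | zero => simp
  | add w w' h h' => simp only [map_add, add_mul, h, h']
  | tmul x y =>
    induction v using TensorProduct.induction_on with
    | zero => simp
    | add w w' h h' => simp only [map_add, mul_add, h, h']
    | tmul x' y' =>
      simp [sliceRight_tmul, apply_mul_of_mem_dualAnnihilator hf y.2, mul_smul]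
      exact smul_comm _ _ _

theorem IsHopfSubalgebra.sliceRight_comul_mem (hB : IsHopfSubalgebra B) {f : Module.Dual ℂ A}
    (hf : f ∈ (BplusA B).dualAnnihilator) {a : A} (ha : a ∈ BplusA B) :
    sliceRight f (comul a) ∈ BplusA B := by
  change a ∈ (BplusA B).comap (sliceRight f ∘ₗ comul)
  refine Submodule.span_le.2 ?_ ha
  rintro _ ⟨b, x, hb, h0, rfl⟩
  refine Submodule.subset_span ⟨b, sliceRight f (comul x), hb, h0, ?_⟩
  simp [hB.sliceRight_comul_mul hf hb]

/-- The map `f ↦ (id ⊗ f)(Δ(t))`. -/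
noncomputable def sliceComul (t : A) : Module.Dual ℂ A →ₗ[ℂ] A where
  toFun f := sliceRight f (comul t)
  map_add' f g := by simp [sliceRight, LinearMap.lTensor_add]
  map_smul' r f := by simp [sliceRight, LinearMap.lTensor_smul]

/-- The right ideal generated by `B⁺A` and the slices of `Δ(t)`. -/
noncomputable def sliceIdeal (B : Subalgebra ℂ A) (t : A) : Submodule ℂ A :=
  BplusA B ⊔ (BplusA B).dualAnnihilator.map (sliceComul t)

theorem mul_mem_sliceIdeal (hB : IsHopfSubalgebra B) {t : A} (ht : IsRightRelIntegral B t)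
    {x : A} (hx : x ∈ sliceIdeal B t) (a : A) : x * a ∈ sliceIdeal B t := by
  obtain ⟨h, hh, _, ⟨f, hf, rfl⟩, rfl⟩ := Submodule.mem_sup.1 hx
  rw [add_mul]
  refine add_mem (Submodule.mem_sup_left (mul_mem_BplusA hh a)) ?_
  let r := ℛ ℂ a
  let g : A → Module.Dual ℂ A := fun y ↦ f ∘ₗ LinearMap.mulRight ℂ (antipode ℂ y)
  have hg : ∀ y, g y ∈ (BplusA B).dualAnnihilator := fun y ↦
    (Submodule.mem_dualAnnihilator _).2 fun h hh ↦
      (Submodule.mem_dualAnnihilator _).1 hf _ (mul_mem_BplusA hh _)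
  have h1 : sliceComul t f * a = sliceRight f (comul t * (a ⊗ₜ 1)) := by
    change sliceRight f (comul t) * a = _
    induction comul (R := ℂ) t using TensorProduct.induction_on with
    | zero => simp
    | add v v' h h' => simp only [map_add, add_mul, h, h']
    | tmul x y => simp [sliceRight_tmul]
  have h2 : ∀ v y, sliceRight f (v * (1 ⊗ₜ antipode ℂ y)) = sliceRight (g y) v := fun v y ↦ by
    induction v using TensorProduct.induction_on with
    | zero => simp
    | add v v' h h' => simp only [map_add, add_mul, h, h']
    | tmul x y => simp [sliceRight_tmul, g]
  rw [h1, ← sum_comul_mul_tmul_antipode r, Finset.mul_sum, map_sum]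
  refine sum_mem fun i _ ↦ ?_
  rw [← mul_assoc, ← Bialgebra.comul_mul, h2,
    ← sub_add_cancel (t * _) (counit (R := ℂ) (r.left i) • t), map_add, map_add]
  refine add_mem (Submodule.mem_sup_left (hB.sliceRight_comul_mem (hg _) (ht _))) ?_
  rw [map_smul, map_smul]
  exact Submodule.smul_mem _ _ (Submodule.mem_sup_right ⟨_, hg _, rfl⟩)

theorem tmul_one_mul_mem_balancedRel {A : Type*} [Ring A] [Algebra ℂ A] {B : Subalgebra ℂ A}
    {N : Submodule ℂ A} {q : A} (hq : ∀ a, q * a ∈ N) (w : A ⊗[ℂ] A) :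
    (q ⊗ₜ 1) * w ∈ balancedRel B N := by
  induction w using TensorProduct.induction_on with
  | zero => simp
  | add v v' h h' => simpa only [mul_add] using add_mem h h'
  | tmul x y => simpa using tmul_mem_balancedRel (hq x) y

theorem one_tmul_mem_balancedRel_sliceIdeal (hB : IsHopfSubalgebra B) {t : A}
    (ht : IsRightRelIntegral B t) : 1 ⊗ₜ t ∈ balancedRel B (sliceIdeal B t) := by
  let r := ℛ ℂ t
  obtain ⟨n, e, g, hg⟩ := exists_dual_sum_smul_eq (K := ℂ)
    (fun i : r.index ↦ (BplusA B).mkQ (r.right i))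
  choose e' he' using fun k ↦ (BplusA B).mkQ_surjective (e k)
  let f : Fin n → Module.Dual ℂ A := fun k ↦ g k ∘ₗ (BplusA B).mkQ
  have hf : ∀ k, f k ∈ (BplusA B).dualAnnihilator := fun k ↦
    (Submodule.mem_dualAnnihilator _).2 fun h hh ↦ by
      simp [f, (Submodule.Quotient.mk_eq_zero _).2 hh]
  have hsub : ∀ i ∈ r.index, r.right i - ∑ k, f k (r.right i) • e' k ∈ BplusA B := fun i hi ↦ by
    rw [← Submodule.ker_mkQ (BplusA B), LinearMap.mem_ker, map_sub, hg ⟨i, hi⟩]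
    simp [f, he']
  have hslice : ∀ k, sliceComul t (f k) = ∑ i ∈ r.index, f k (r.right i) • r.left i := fun k ↦ by
    change sliceRight _ (comul t) = _
    rw [← r.eq, map_sum]
    simp [sliceRight_tmul]
  have key : 1 ⊗ₜ t = ∑ i ∈ r.index, (r.left i ⊗ₜ 1) *
        antipodeComul A (r.right i - ∑ k, f k (r.right i) • e' k) +
      ∑ k, (sliceComul t (f k) ⊗ₜ 1) * antipodeComul A (e' k) := by
    have h1 := sum_tmul_mul_antipodeComul r 1
    simp only [one_mul] at h1
    rw [show antipodeComul A 1 = 1 by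
      simp [antipodeComul, Algebra.TensorProduct.one_def, antipode_one], one_mul] at h1
    rw [← h1]
    simp only [hslice, map_sub, mul_sub, Finset.sum_sub_distrib, map_sum, map_smul,
      TensorProduct.sum_tmul, Finset.sum_mul, Finset.mul_sum]
    rw [Finset.sum_comm (s := Finset.univ)]
    simp [← TensorProduct.smul_tmul']
  rw [key]
  refine add_mem (sum_mem fun i hi ↦ ?_) (sum_mem fun k _ ↦ ?_)
  · have := outerMul_mem_balancedRel (hB.antipodeComul_mem (hsub i hi)) (r.left i ⊗ₜ 1)
    rw [outerMul_tmul, ← Algebra.TensorProduct.one_def, mul_one] at this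
    exact balancedRel_mono bot_le this
  · exact tmul_one_mul_mem_balancedRel (mul_mem_sliceIdeal hB ht
      (Submodule.mem_sup_right ⟨_, hf k, rfl⟩)) _

theorem sliceIdeal_eq_top (hB : IsHopfSubalgebra B) (hflat : LeftFlat B A) {t : A}
    (ht : IsRightRelIntegral B t) (hεt : counit (R := ℂ) t ≠ 0) : sliceIdeal B t = ⊤ := by
  suffices h1 : 1 ∈ sliceIdeal B t from
    top_unique fun a _ ↦ by simpa using mul_mem_sliceIdeal hB ht h1 a
  by_contra h1
  obtain ⟨m, c, y, hty, hc⟩ := hflat.exists_of_sum_tmul_mem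
    (fun n hn b _ ↦ mul_mem_sliceIdeal hB ht hn b) (fun _ : Unit ↦ (1 : A)) (fun _ ↦ t)
    (by simpa using one_tmul_mem_balancedRel_sliceIdeal hB ht)
  refine hεt (counit_eq_zero_of_mem_BplusA (B := B) ?_)
  rw [hty ()]
  refine sum_mem fun j _ ↦ Submodule.subset_span ⟨c () j, y j, (c () j).2, ?_, rfl⟩
  by_contra h0
  refine h1 (((sliceIdeal B t).smul_mem_iff h0).1 ?_)
  simpa using sub_mem (hc j) (Submodule.mem_sup_left (sub_counit_smul_one_mem (c () j).2))

theorem finite_quotient_BplusA (hB : IsHopfSubalgebra B) (hflat : LeftFlat B A) {t : A}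
    (ht : IsRightRelIntegral B t) (hεt : counit (R := ℂ) t ≠ 0) :
    Module.Finite ℂ (A ⧸ BplusA B) := by
  classical
  let r := ℛ ℂ t
  refine ⟨r.index.image (fun i ↦ (BplusA B).mkQ (r.left i)), top_unique fun q _ ↦ ?_⟩
  obtain ⟨a, rfl⟩ := (BplusA B).mkQ_surjective q
  have ha : a ∈ sliceIdeal B t := sliceIdeal_eq_top hB hflat ht hεt ▸ Submodule.mem_top
  obtain ⟨h, hh, _, ⟨f, hf, rfl⟩, rfl⟩ := Submodule.mem_sup.1 ha
  have : sliceComul t f = ∑ i ∈ r.index, f (r.right i) • r.left i := by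
    change sliceRight _ (comul t) = _
    rw [← r.eq, map_sum]
    simp [sliceRight_tmul]
  rw [map_add, show (BplusA B).mkQ h = 0 from (Submodule.Quotient.mk_eq_zero _).2 hh, zero_add,
    this, map_sum]
  refine sum_mem fun i hi ↦ ?_
  rw [map_smul]
  exact Submodule.smul_mem _ _ (Submodule.subset_span 
    (Finset.mem_image_of_mem _ hi))

theorem finite_quotient_mulBplus (hS : Function.Bijective (antipode ℂ (A := A)))
    (hB : IsHopfSubalgebra B) [Module.Finite ℂ (A ⧸ BplusA B)] :
    Module.Finite ℂ (A ⧸ mulBplus B) := by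
  have h : BplusA B ≤ (mulBplus B).comap (antipode ℂ) := by
    refine Submodule.span_le.2 ?_
    rintro _ ⟨b, a, hb, h0, rfl⟩
    exact Submodule.subset_span ⟨antipode ℂ a, antipode ℂ b, hB.2 b hb, by simp [h0],
      antipode_mul_antidistrib b a⟩
  refine Module.Finite.of_surjective (Submodule.mapQ _ _ _ h) fun q ↦ ?_
  obtain ⟨a, rfl⟩ := (mulBplus B).mkQ_surjective q
  obtain ⟨a, rfl⟩ := hS.2 a
  exact ⟨(BplusA B).mkQ a, rfl⟩

end Finiteness

section RightProjectivity

open Coalgebra HopfAlgebra WithConv Algebra.TensorProduct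

variable {A : Type u} [Ring A] [HopfAlgebra ℂ A] {B : Subalgebra ℂ A}

theorem comul_antipode (a : A) : comul (R := ℂ) (antipode ℂ a) =
    TensorProduct.comm ℂ A A (TensorProduct.map (antipode ℂ) (antipode ℂ) (comul a)) := by
  have h : toConv ((TensorProduct.comm ℂ A A).toLinearMap ∘ₗ
      TensorProduct.map (antipode ℂ) (antipode ℂ) ∘ₗ comul) =
      toConv (includeRight.toLinearMap ∘ₗ antipode ℂ (A := A)) *
        toConv ((includeLeft (S := ℂ)).toLinearMap ∘ₗ antipode ℂ) := by
    ext y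
    simp only [LinearMap.convMul_apply, LinearMap.comp_apply]
    generalize comul (R := ℂ) y = v
    induction v using TensorProduct.induction_on with
    | zero => simp
    | add v v' h h' => simp only [map_add, ← h, ← h']
    | tmul x x' => simp
  have h' : toConv ((TensorProduct.comm ℂ A A).toLinearMap ∘ₗ
      TensorProduct.map (antipode ℂ) (antipode ℂ) ∘ₗ comul) * toConv (comul (R := ℂ)) = 1 := by
    rw [h, toConv_comul_eq, mul_assoc, ← mul_assoc _ _ (toConv includeRight.toLinearMap),
      antipode_conv_algHom, one_mul, antipode_conv_algHom]
  exact (congrArg (fun f ↦ f.ofConv a)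
    (left_inv_eq_right_inv h' LinearMap.comul_right_inv)).symm

/-- The preimage of a Hopf subalgebra under the antipode is contained in the Hopf subalgebra. -/
theorem IsHopfSubalgebra.mem_of_antipode_mem (hB : IsHopfSubalgebra B)
    (hS : Function.Bijective (antipode ℂ (A := A))) (hflat : LeftFaithfullyFlat B A) {a : A}
    (ha : antipode ℂ a ∈ B) : a ∈ B := by
  let T := (LinearEquiv.ofBijective _ hS).symm.toLinearMap
  have hT : T ∘ₗ antipode ℂ = .id := by
    ext x
    exact (LinearEquiv.ofBijective _ hS).symm_apply_apply x
  have hS' : ∀ x, antipode ℂ x ∈ B → ∃ w : B ⊗[ℂ] B,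
      TensorProduct.map (antipode ℂ) (antipode ℂ) (comul x) =
        TensorProduct.map B.val.toLinearMap B.val.toLinearMap w := fun x hx ↦ by
    obtain ⟨w, hw⟩ := hB.1 _ hx
    refine ⟨TensorProduct.comm ℂ B B w, (TensorProduct.comm ℂ A A).injective ?_⟩
    rw [← comul_antipode, ← hw, TensorProduct.map_comm, ← LinearEquiv.coe_coe]
    simp
  have hlam : ∀ x, antipode ℂ x ∈ B →
      comulAntipode A x - counit (R := ℂ) x • 1 ∈ balancedRel B B.toSubmodule := fun x hx ↦ by
    obtain ⟨w, hw⟩ := hS' x hx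
    have h1 : TensorProduct.map (T ∘ₗ B.val.toLinearMap) (B.val.toLinearMap ∘ₗ .id) w =
        comulAntipode A x := by
      have := congrArg (T.rTensor A) hw
      rw [LinearMap.rTensor, TensorProduct.map_map, TensorProduct.map_map, hT] at this
      exact this.symm
    have h := mul'_tmul_one_sub_mem_balancedRel (N := B.toSubmodule) (T ∘ₗ B.val.toLinearMap) .id w
    rw [h1, comulAntipode, LinearMap.comp_apply, mul_antipode_lTensor_comul_apply,
      Algebra.algebraMap_eq_smul_one, ← TensorProduct.smul_tmul'] at h
    rw [← neg_mem_iff, neg_sub]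
    exact h
  obtain ⟨w, hw⟩ := hS' a ha
  obtain ⟨s, rfl⟩ := TensorProduct.exists_finset w
  let r : Repr ℂ a (B × B) :=
    { index := s
      left := fun i ↦ T i.1
      right := fun i ↦ T i.2
      eq := by
        have := congrArg (TensorProduct.map T T) hw
        rw [TensorProduct.map_map, hT, TensorProduct.map_id] at this
        rw [← LinearMap.id_apply (R := ℂ) (comul a), this]
        simp }
  refine hflat.mem_of_tmul_one_mem (N := B.toSubmodule) (fun n hn b hb ↦ B.mul_mem hn hb) ?_
  have key : a ⊗ₜ 1 = ∑ i ∈ r.index, (comulAntipode A (r.left i) -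
      counit (R := ℂ) (r.left i) • 1) * (1 ⊗ₜ r.right i) + 1 ⊗ₜ a := by
    conv_rhs => enter [2]; rw [← sum_counit_smul r, TensorProduct.tmul_sum]
    rw [← Finset.sum_add_distrib, ← sum_comulAntipode_mul_tmul r]
    simp [sub_mul]
  rw [key]
  refine add_mem (sum_mem fun i _ ↦ mul_one_tmul_mem_balancedRel (hlam _ ?_) _)
    (tmul_mem_balancedRel (one_mem B) a)
  change antipode ℂ (T i.1) ∈ B
  rw [show antipode ℂ (T i.1) = i.1 from (LinearEquiv.ofBijective _ hS).apply_symm_apply i.1]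
  exact i.1.2

/-- Right flatness of `A` over `B`, obtained from left flatness through the antipode. -/
theorem LeftFlat.exists_right_factorization (hB : IsHopfSubalgebra B)
    (hS : Function.Bijective (antipode ℂ (A := A))) (hflat : LeftFaithfullyFlat B A)
    {ι σ : Type*} [Fintype ι] [Finite σ] (x : ι → A) (ρ : σ → ι → B)
    (hρ : ∀ s, ∑ i, x i * ρ s i = 0) :
    ∃ (m : ℕ) (c : ι → Fin m → B) (y : Fin m → A),
      (∀ i, x i = ∑ j, y j * c i j) ∧ ∀ s j, ∑ i, c i j * ρ s i = 0 := by
  obtain ⟨m, c, y, hx, hc⟩ := hflat.1.exists_factorization (fun i ↦ antipode ℂ (x i))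
    (fun s i ↦ (⟨antipode ℂ (ρ s i : A), hB.2 _ (ρ s i).2⟩ : B)) (fun s ↦ by
      simpa [Subalgebra.smul_def, antipode_mul_antidistrib] using
        congrArg (antipode ℂ) (hρ s))
  choose y' hy' using fun j ↦ hS.2 (y j)
  choose c' hc' using fun i j ↦ hS.2 (c i j)
  have hcB : ∀ i j, c' i j ∈ B := fun i j ↦ hB.mem_of_antipode_mem hS hflat (hc' i j ▸ (c i j).2)
  refine ⟨m, fun i j ↦ ⟨c' i j, hcB i j⟩, y', fun i ↦ hS.1 ?_, fun s j ↦ ?_⟩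
  · simp [hx, antipode_mul_antidistrib, hy', hc', Subalgebra.smul_def]
  · have := congrArg (Subtype.val : B → A) (hc s j)
    refine Subtype.ext (hS.1 ?_)
    simpa [antipode_mul_antidistrib, hc'] using this

/-- The map `x ⊗ y ↦ f(x) y`. -/
noncomputable def sliceLeft {A : Type*} [Ring A] [Algebra ℂ A] (f : Module.Dual ℂ A) :
    A ⊗[ℂ] A →ₗ[ℂ] A :=
  TensorProduct.lid ℂ A ∘ₗ f.rTensor A

theorem sliceLeft_tmul {A : Type*} [Ring A] [Algebra ℂ A] (f : Module.Dual ℂ A) (x y : A) :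
    sliceLeft f (x ⊗ₜ y) = f x • y := by
  simp [sliceLeft]

theorem IsHopfSubalgebra.sliceLeft_mul_comul (hB : IsHopfSubalgebra B) {f : Module.Dual ℂ A}
    (hf : ∀ a, ∀ b ∈ B, f (a * b) = f a * counit (R := ℂ) b) {b : A} (hb : b ∈ B)
    (v : A ⊗[ℂ] A) : sliceLeft f (v * comul b) = sliceLeft f v * b := by
  obtain ⟨w, hw⟩ := hB.1 b hb
  have hb' : b = sliceLeft counit (comul (R := ℂ) b) := by
    simp [sliceLeft, rTensor_counit_comul]
  conv_rhs => rw [hb']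
  rw [← hw]
  clear hb' hw
  induction w using TensorProduct.induction_on with
  | zero => simp
  | add w w' h h' => simp only [map_add, mul_add, h, h']
  | tmul x y =>
    induction v using TensorProduct.induction_on with
    | zero => simp
    | add w w' h h' => simp only [map_add, add_mul, h, h']
    | tmul x' y' =>
      simp [sliceLeft_tmul, hf _ _ x.2, mul_smul]
      exact smul_comm _ _ _

/-- If `A / AB⁺` is finite dimensional then `a ⊗_B 1 = ∑ i, y i ⊗_B σ i a` for finitely many
elements `y i` of `A` and right `B`-linear endomorphisms `σ i`. -/
theorem exists_sum_tmul_sub_mem_balancedRel (hB : IsHopfSubalgebra B)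
    [Module.Finite ℂ (A ⧸ mulBplus B)] :
    ∃ (J : Type u) (_ : Fintype J) (y : J → A) (σ : J → A →ₗ[ℂ] A),
      (∀ i a, ∀ b ∈ B, σ i (a * b) = σ i a * b) ∧
        ∀ a, a ⊗ₜ 1 - ∑ i, y i ⊗ₜ σ i a ∈ balancedRel B ⊥ := by
  let e := Module.finBasis ℂ (A ⧸ mulBplus B)
  choose x hx using fun k ↦ (mulBplus B).mkQ_surjective (e k)
  let φ := fun k ↦ e.coord k ∘ₗ (mulBplus B).mkQ
  have hφ : ∀ k a, ∀ b ∈ B, φ k (a * b) = φ k a * counit (R := ℂ) b := fun k a b hb ↦ by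
    have h : a * (b - counit (R := ℂ) b • 1) ∈ mulBplus B :=
      Submodule.subset_span ⟨a, _, sub_mem hb (B.smul_mem (one_mem B) _), by simp, rfl⟩
    have h0 : φ k (a * (b - counit (R := ℂ) b • 1)) = 0 := by
      simp only [φ, LinearMap.comp_apply]
      rw [show (mulBplus B).mkQ _ = 0 from (Submodule.Quotient.mk_eq_zero _).2 h, map_zero]
    rw [mul_sub, map_sub, mul_smul_comm, mul_one, map_smul, sub_eq_zero] at h0
    rw [h0, smul_eq_mul, mul_comm]
  have hsub : ∀ a, a - ∑ k, φ k a • x k ∈ mulBplus B := fun a ↦ by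
    refine (Submodule.Quotient.mk_eq_zero _).1 (show (mulBplus B).mkQ _ = 0 from ?_)
    rw [map_sub, map_sum, sub_eq_zero]
    simp only [map_smul, hx]
    exact (e.sum_repr _).symm
  let r := fun k ↦ ℛ ℂ (x k)
  refine ⟨Σ k, (r k).index, inferInstance, fun j ↦ (r j.1).left j.2, fun j ↦
    LinearMap.mulLeft ℂ (antipode ℂ ((r j.1).right j.2)) ∘ₗ sliceLeft (φ j.1) ∘ₗ comul,
    fun i a b hb ↦ ?_, fun a ↦ ?_⟩
  · simp [hB.sliceLeft_mul_comul (hφ _) hb, mul_assoc]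
  · let q := ℛ ℂ a
    have h1 : ∀ k, comulAntipode A (x k) =
        ∑ j : (r k).index, (r k).left j ⊗ₜ antipode ℂ ((r k).right j) := fun k ↦ by
      rw [comulAntipode, LinearMap.comp_apply, ← (r k).eq, map_sum, ← Finset.sum_coe_sort]
      rfl
    have h2 : ∀ k, sliceLeft (φ k) (comul a) = ∑ i ∈ q.index, φ k (q.left i) • q.right i :=
      fun k ↦ by
        rw [← q.eq, map_sum]
        simp [sliceLeft_tmul]
    have key : a ⊗ₜ 1 - ∑ j : Σ k, (r k).index, (r j.1).left j.2 ⊗ₜ[ℂ]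
        (antipode ℂ ((r j.1).right j.2) * sliceLeft (φ j.1) (comul a)) =
        ∑ i ∈ q.index, comulAntipode A (q.left i - ∑ k, φ k (q.left i) • x k) *
          (1 ⊗ₜ q.right i) := by
      simp only [map_sub, sub_mul, Finset.sum_sub_distrib, sum_comulAntipode_mul_tmul q]
      congr 1
      rw [Fintype.sum_sigma]
      simp only [h1, h2, map_sum, map_smul, Finset.sum_mul, Finset.mul_sum, Finset.smul_sum,
        TensorProduct.tmul_sum, smul_mul_assoc, mul_smul_comm, TensorProduct.tmul_smul,
        tmul_mul_tmul, mul_one]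
      rw [Finset.sum_comm (t := Finset.univ)]
      exact Finset.sum_congr rfl fun k _ ↦ Finset.sum_comm
    change _ - ∑ j : Σ k, (r k).index, (r j.1).left j.2 ⊗ₜ[ℂ]
        (antipode ℂ ((r j.1).right j.2) * sliceLeft (φ j.1) (comul a)) ∈ _
    rw [key]
    exact sum_mem fun i _ ↦ mul_one_tmul_mem_balancedRel (hB.comulAntipode_mem (hsub _)) _

theorem fgProjRight (hB : IsHopfSubalgebra B) (hS : Function.Bijective (antipode ℂ (A := A)))
    (hflat : LeftFaithfullyFlat B A) [Module.Finite ℂ (A ⧸ mulBplus B)] : FGProjRight B := by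
  classical
  obtain ⟨J, _, y, σ, hσ, hyσ⟩ := exists_sum_tmul_sub_mem_balancedRel hB
  have hgen : ∀ a, ∃ b : J → B, a = ∑ j, y j * b j := fun a ↦ by
    let N : Submodule ℂ A := LinearMap.range
      (∑ j, LinearMap.mulLeft ℂ (y j) ∘ₗ B.val.toLinearMap ∘ₗ LinearMap.proj j :
        (J → B) →ₗ[ℂ] A)
    have hN : ∀ n, n ∈ N ↔ ∃ b : J → B, n = ∑ j, y j * b j := fun n ↦ by
      simp [N, LinearMap.sum_apply, eq_comm]
    refine (hN a).1 (hflat.mem_of_tmul_one_mem (fun n hn b hb ↦ ?_) ?_)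
    · obtain ⟨c, rfl⟩ := (hN n).1 hn
      exact (hN _).2 ⟨fun j ↦ c j * ⟨b, hb⟩, by simp [Finset.sum_mul, mul_assoc]⟩
    · rw [← sub_add_cancel (a ⊗ₜ 1) (∑ i, y i ⊗ₜ σ i a)]
      refine add_mem (balancedRel_mono bot_le (hyσ a))
        (sum_mem fun i _ ↦ tmul_mem_balancedRel ((hN _).2 ⟨Pi.single i 1, ?_⟩) _)
      rw [Fintype.sum_eq_single i (fun j hj ↦ by simp [hj])]
      simp
  let g : J → J → A := fun j i ↦ (if i = j then 1 else 0) - σ i (y j)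
  have hg : ∀ j, ∃ (m : ℕ) (c : J → Fin m → B) (z : Fin m → A),
      (∀ i, g j i = ∑ l, c i l • z l) ∧ ∀ l, ∑ i, y i * c i l = 0 := fun j ↦ by
    obtain ⟨m, c, z, h1, h2⟩ := hflat.1.exists_of_sum_tmul_mem (N := ⊥) (by simp) y (g j) (by
      simpa [g, TensorProduct.tmul_sub, TensorProduct.tmul_ite] using hyσ (y j))
    exact ⟨m, c, z, h1, h2⟩
  choose m c z hgc hyc using hg
  obtain ⟨k, d, w, hyd, hdc⟩ := LeftFlat.exists_right_factorization hB hS hflat y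
    (fun (s : Σ j, Fin (m j)) i ↦ c s.1 i s.2) (fun s ↦ hyc s.1 s.2)
  have hdg : ∀ l j, ∑ i, (d i l : A) * g j i = 0 := fun l j ↦ by
    simp only [hgc, Subalgebra.smul_def, smul_eq_mul, Finset.mul_sum, ← mul_assoc]
    rw [Finset.sum_comm]
    refine Finset.sum_eq_zero fun p _ ↦ ?_
    rw [← Finset.sum_mul]
    have := congrArg (Subtype.val : B → A) (hdc ⟨j, p⟩ l)
    push_cast at this
    rw [this, zero_mul]
  let F : Fin k → A →ₗ[ℂ] A := fun l ↦ ∑ i, LinearMap.mulLeft ℂ (d i l : A) ∘ₗ σ i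
  have hF : ∀ l (b : J → B), F l (∑ j, y j * b j) = ∑ i, (d i l : A) * b i := fun l b ↦ by
    have h1 : ∀ i, σ i (∑ j, y j * b j) = b i - ∑ j, g j i * b j := fun i ↦ by
      simp [g, hσ _ _ _ (b _).2, sub_mul]
    simp only [F, LinearMap.sum_apply, LinearMap.comp_apply, LinearMap.mulLeft_apply, h1, mul_sub,
      Finset.sum_sub_distrib, Finset.mul_sum, ← mul_assoc]
    rw [Finset.sum_comm (f := fun i j ↦ (d i l : A) * g j i * b j)]
    simp [← Finset.sum_mul, hdg]
  have hFB : ∀ l a, F l a ∈ B := fun l a ↦ by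
    obtain ⟨b, rfl⟩ := hgen a
    rw [hF]
    exact sum_mem fun i _ ↦ mul_mem (d i l).2 (b i).2
  refine ⟨k, w, fun l ↦ (F l).codRestrict B.toSubmodule (hFB l), fun l a b ↦ Subtype.ext ?_,
    fun a ↦ ?_⟩
  · change F l (a * b) = F l a * b
    simp [F, LinearMap.sum_apply, hσ _ _ _ b.2, Finset.sum_mul, mul_assoc]
  · change a = ∑ l, w l * F l a
    obtain ⟨b, rfl⟩ := hgen a
    simp only [hF, Finset.mul_sum, ← mul_assoc]
    rw [Finset.sum_comm]
    simp only [← Finset.sum_mul, ← hyd]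

end RightProjectivity

section Restriction

variable {A : Type u} [Ring A] [Algebra ℂ A] (B : Subalgebra ℂ A)

/-- The right `B`-module structure on a right `A`-module obtained by restriction. -/
@[reducible]
def restrictOp (M : Type*) [AddCommGroup M] [Module Aᵐᵒᵖ M] : Module (↥B)ᵐᵒᵖ M :=
  Module.compHom M B.val.toRingHom.op

variable {B}

theorem FGProjRight.projective_op (h : FGProjRight B) :
    letI := restrictOp B Aᵐᵒᵖ
    Module.Projective (↥B)ᵐᵒᵖ Aᵐᵒᵖ := by
  let _ := restrictOp B Aᵐᵒᵖ
  have hsmul : ∀ (b : (↥B)ᵐᵒᵖ) (a : Aᵐᵒᵖ), b • a = op (a.unop * b.unop) := fun _ _ ↦ rfl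
  obtain ⟨k, x, f, hf, hx⟩ := h
  let i : Aᵐᵒᵖ →ₗ[(↥B)ᵐᵒᵖ] Fin k → (↥B)ᵐᵒᵖ :=
    { toFun := fun a l ↦ op (f l a.unop)
      map_add' := fun a a' ↦ by ext; simp
      map_smul' := fun b a ↦ by
        ext l
        simp [hsmul, hf] }
  let s : (Fin k → (↥B)ᵐᵒᵖ) →ₗ[(↥B)ᵐᵒᵖ] Aᵐᵒᵖ :=
    { toFun := fun c ↦ op (∑ l, x l * (c l).unop)
      map_add' := fun c c' ↦ by simp [mul_add, Finset.sum_add_distrib]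
      map_smul' := fun b c ↦ by simp [hsmul, Finset.sum_mul, mul_assoc] }
  refine Module.Projective.of_split i s (LinearMap.ext fun a ↦ unop_injective ?_)
  exact (hx a.unop).symm

end Restriction

section Maschke

open Coalgebra HopfAlgebra WithConv Algebra.TensorProduct

variable {A : Type u} [Ring A] [HopfAlgebra ℂ A] {B : Subalgebra ℂ A}

/-- A normalized relative integral gives a separability element of `A` over `B`. -/
theorem IsRightRelIntegral.antipodeComul_mul_sub_mem (hB : IsHopfSubalgebra B) {t : A}
    (ht : IsRightRelIntegral B t) (a : A) :
    antipodeComul A t * (1 ⊗ₜ a) - (a ⊗ₜ 1) * antipodeComul A t ∈ balancedRel B ⊥ := by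
  let r := ℛ ℂ a
  have hr : ∑ i ∈ r.index, counit (R := ℂ) (r.right i) • r.left i = a := by
    simpa only [map_sum, TensorProduct.rid_tmul, one_smul] using
      congrArg (TensorProduct.rid ℂ A) (sum_tmul_counit_eq r)
  have h : (a ⊗ₜ[ℂ] 1) * antipodeComul A t =
      ∑ i ∈ r.index, (r.left i ⊗ₜ 1) * antipodeComul A (counit (R := ℂ) (r.right i) • t) := by
    conv_lhs => rw [← hr]
    simp [Finset.sum_mul, TensorProduct.sum_tmul, ← TensorProduct.smul_tmul']
  rw [← sum_tmul_mul_antipodeComul r t, h, ← Finset.sum_sub_distrib]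
  refine sum_mem fun i _ ↦ ?_
  rw [← mul_sub, ← map_sub]
  simpa [outerMul_tmul, ← one_def] using
    outerMul_mem_balancedRel (hB.antipodeComul_mem (ht (r.right i))) (r.left i ⊗ₜ 1)

theorem mul'_antipodeComul (t : A) :
    LinearMap.mul' ℂ A (antipodeComul A t) = counit (R := ℂ) t • 1 := by
  rw [antipodeComul, LinearMap.comp_apply, mul_antipode_rTensor_comul_apply,
    Algebra.algebraMap_eq_smul_one]

/-- A right `A`-module which is projective over `B` is projective over `A` if there is a relative
integral which is not annihilated by the counit. -/
theorem IsRightRelIntegral.projective (hB : IsHopfSubalgebra B) {t : A}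
    (ht : IsRightRelIntegral B t) (hεt : counit (R := ℂ) t ≠ 0) {M : Type*} [AddCommGroup M]
    [Module Aᵐᵒᵖ M] [Module (↥B)ᵐᵒᵖ M] (hM : ∀ (b : (↥B)ᵐᵒᵖ) (m : M), b • m = op (b.unop : A) • m)
    (hproj : Module.Projective (↥B)ᵐᵒᵖ M) : Module.Projective Aᵐᵒᵖ M := by
  let F := M →₀ Aᵐᵒᵖ
  let π : F →ₗ[Aᵐᵒᵖ] M := Finsupp.linearCombination Aᵐᵒᵖ id
  let _ : Module (↥B)ᵐᵒᵖ F := restrictOp B F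
  let πB : F →ₗ[(↥B)ᵐᵒᵖ] M :=
    { π with map_smul' := fun b m ↦ (π.map_smul (op (b.unop : A)) m).trans (hM b _).symm }
  obtain ⟨s, hs⟩ := Module.projective_lifting_property πB .id
    (Finsupp.linearCombination_id_surjective _ _)
  have hs' : ∀ m, π (s m) = m := fun m ↦ LinearMap.congr_fun hs m
  have hsB : ∀ b ∈ B, ∀ m, s (op b • m) = op b • s m := fun b hb m ↦ by
    have h1 := s.map_smul (op (⟨b, hb⟩ : B)) m
    rwa [hM] at h1
  let φ : M → A →+ A →+ F := fun m ↦
    { toFun := fun x ↦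
        { toFun := fun y ↦ op y • s (op x • m)
          map_zero' := by simp
          map_add' := fun y y' ↦ by simp [add_smul] }
      map_zero' := by ext; simp
      map_add' := fun x x' ↦ by ext; simp [add_smul] }
  let Φ : M → A ⊗[ℂ] A →+ F := fun m ↦ TensorProduct.liftAddHom (φ m) fun r x y ↦ by
    change op y • s (op (r • x) • m) = op (r • y) • s (op x • m)
    rw [Algebra.smul_def, Algebra.commutes, op_mul, mul_smul, hsB _ (B.algebraMap_mem r),
      smul_smul, ← op_mul, Algebra.smul_def]
  have hΦ : ∀ m x y, Φ m (x ⊗ₜ y) = op y • s (op x • m) := fun _ _ _ ↦ rfl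
  have hΦB : ∀ m, ∀ w ∈ balancedRel B ⊥, Φ m w = 0 := fun m w hw ↦ by
    obtain ⟨κ, _, x, y, n, z, b, hn, rfl⟩ := exists_sum_eq_of_mem_balancedRel hw
    rw [map_sum]
    refine Finset.sum_eq_zero fun l _ ↦ ?_
    rw [(Submodule.mem_bot ℂ).1 (hn l), TensorProduct.zero_tmul, add_zero, map_sub, hΦ, hΦ,
      op_mul, op_mul, mul_smul, mul_smul, hsB _ (b l).2, sub_self]
  have hΦr : ∀ m w a, Φ m (w * (1 ⊗ₜ a)) = op a • Φ m w := fun m w a ↦ by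
    induction w using TensorProduct.induction_on with
    | zero => simp
    | add w w' h h' => simp only [add_mul, map_add, h, h', smul_add]
    | tmul x y => simp [hΦ, mul_smul]
  have hΦl : ∀ m w a, Φ (op a • m) w = Φ m ((a ⊗ₜ 1) * w) := fun m w a ↦ by
    induction w using TensorProduct.induction_on with
    | zero => simp
    | add w w' h h' => simp only [mul_add, map_add, h, h']
    | tmul x y => simp [hΦ, mul_smul]
  have hΦπ : ∀ m w, π (Φ m w) = op (LinearMap.mul' ℂ A w) • m := fun m w ↦ by
    induction w using TensorProduct.induction_on with
    | zero => simp
    | add w w' h h' => simp only [map_add, h, h', op_add, add_smul]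
    | tmul x y => simp [hΦ, hs', mul_smul]
  let k := antipodeComul A ((counit (R := ℂ) t)⁻¹ • t)
  have hk : ∀ a, k * (1 ⊗ₜ a) - (a ⊗ₜ 1) * k ∈ balancedRel B ⊥ := fun a ↦ by
    simp only [k, map_smul, smul_mul_assoc, mul_smul_comm, ← smul_sub]
    exact Submodule.smul_mem _ _ (ht.antipodeComul_mul_sub_mem hB a)
  let σ : M →ₗ[Aᵐᵒᵖ] F :=
    { toFun := fun m ↦ Φ m k
      map_add' := fun m m' ↦ by
        generalize k = w
        induction w using TensorProduct.induction_on with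
        | zero => simp
        | add w w' h h' =>
          simp only [map_add, h, h']
          abel
        | tmul x y => simp [hΦ]
      map_smul' := fun a m ↦ by
        have h := hΦB m _ (hk a.unop)
        rw [map_sub, sub_eq_zero, hΦr, ← hΦl] at h
        exact h.symm }
  refine Module.Projective.of_split σ π (LinearMap.ext fun m ↦ ?_)
  change π (Φ m k) = m
  rw [hΦπ, mul'_antipodeComul, map_smul, smul_eq_mul, inv_mul_cancel₀ hεt, one_smul, op_one,
    one_smul]

end Maschke

/-- Proposition 3.5(3): let `A` be a Hopf algebra with bijective
antipode, `B ⊆ A` a Hopf subalgebra such that `A` is faithfully flat as a left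
`B`-module, and suppose there is a right `A/B`-integral `t` with `ε(t) ≠ 0`. Then the
projective dimension of the trivial right `A`-module `ℂ_ε` over `A` equals the projective
dimension of the trivial right `B`-module over `B`, i.e. `cd(A) = cd(B)`. -/
theorem projective_dimension_eq (A : Type) [Ring A] [HopfAlgebra ℂ A]
    (hS : Function.Bijective (HopfAlgebra.antipode (R := ℂ) (A := A)))
    (B : Subalgebra ℂ A) (hB : IsHopfSubalgebra B)
    (hflat : LeftFaithfullyFlat ↥B A)
    (t : A) (ht : IsRightRelIntegral B t)
    (hεt : Coalgebra.counit (R := ℂ) t ≠ 0) :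
    ∀ n : ℕ,
      (@pdLE Aᵐᵒᵖ _ n ℂ _ (trivModOp A (Bialgebra.counitAlgHom ℂ A)))
      ↔ (@pdLE (↥B)ᵐᵒᵖ _ n ℂ _ (trivModOp ↥B ((Bialgebra.counitAlgHom ℂ A).comp B.val))) := by
  intro n
  let _ : Module Aᵐᵒᵖ ℂ := trivModOp A (Bialgebra.counitAlgHom ℂ A)
  let _ : Module (↥B)ᵐᵒᵖ ℂ := trivModOp ↥B ((Bialgebra.counitAlgHom ℂ A).comp B.val)
  let _ : Module (↥B)ᵐᵒᵖ Aᵐᵒᵖ := restrictOp B Aᵐᵒᵖ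
  have hsmul : ∀ (b : (↥B)ᵐᵒᵖ) (a : Aᵐᵒᵖ), b • a = op (b.unop : A) * a := fun _ _ ↦ rfl
  have : IsScalarTower (↥B)ᵐᵒᵖ Aᵐᵒᵖ Aᵐᵒᵖ :=
    ⟨fun b x y ↦ by rw [hsmul, smul_eq_mul, smul_eq_mul, mul_assoc, hsmul]⟩
  have : IsScalarTower (↥B)ᵐᵒᵖ Aᵐᵒᵖ ℂ := ⟨fun b x y ↦ by
    rw [hsmul, mul_smul]
    rfl⟩
  have := finite_quotient_BplusA hB hflat.1 ht hεt
  have := finite_quotient_mulBplus hS hB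
  have : Module.Projective (↥B)ᵐᵒᵖ Aᵐᵒᵖ := (fgProjRight hB hS hflat).projective_op
  refine pdLE_iff_of_tower (fun M _ _ _ _ hM ↦ ht.projective hB hεt (fun b m ↦ ?_) hM) n ℂ
  rw [← mul_one (op (b.unop : A)), ← hsmul, smul_assoc, one_smul]
end

section
/- Let A be a Hopf algebra over ℂ of Kac type (i.e., S ∘ S = id), and let B ⊆ A be a Hopf subalgebra such that A is finitely generated as a left B-module. Then there exists a right A/B-integral t ∈ A with ε(t) ≠ 0, i.e., an element t ∈ A with ε(t) ≠ 0 such that ta − ε(a)t ∈ B⁺A for all a ∈ A. -/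
open MulOpposite

namespace RelativeIntegral

open Coalgebra HopfAlgebra TensorProduct

section Hopf

variable {R A : Type*} [CommRing R] [Ring A] [HopfAlgebra R A]

lemma sum_comul_mul_one_tmul_antipode {ι : Type*} {a : A} (r : Repr R a ι) :
    ∑ i ∈ r.index, comul (R := R) (r.left i) * ((1 : A) ⊗ₜ[R] antipode R (r.right i)) =
      a ⊗ₜ[R] (1 : A) := by
  have h := congrArg
    ((LinearMap.mul' R A ∘ₗ (antipode R).lTensor A).lTensor A) (coassoc_apply (R := R) a)
  rw [← LinearMap.comp_apply (LinearMap.lTensor A _) (LinearMap.lTensor A _),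
    ← LinearMap.lTensor_comp, LinearMap.comp_assoc,
    mul_antipode_lTensor_comul, LinearMap.lTensor_comp_apply A (Algebra.linearMap R A),
    lTensor_counit_comul] at h
  simp only [LinearMap.lTensor_comp_apply, LinearMap.lTensor_tmul, Algebra.linearMap_apply,
    map_one] at h
  rw [← h, ← r.eq]
  simp only [map_sum, LinearMap.rTensor_tmul]
  refine Finset.sum_congr rfl fun i _ ↦ ?_
  induction comul (R := R) (r.left i) using TensorProduct.induction_on with
  | zero => simp
  | tmul x y => simp
  | add x y hx hy => simp only [add_mul, hx, hy, TensorProduct.add_tmul, map_add]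

lemma sum_antipode_right_mul_left (hS : ∀ a : A, antipode R (antipode R a) = a)
    {ι : Type*} {a : A} (r : Repr R a ι) :
    ∑ i ∈ r.index, antipode R (r.right i) * r.left i = counit (R := R) a • 1 := by
  have h := congrArg (antipode R) (sum_antipode_mul_eq_smul r)
  simpa [antipode_mul_antidistrib, hS] using h

end Hopf

variable {A : Type*} [Ring A] [HopfAlgebra ℂ A] (B : Subalgebra ℂ A)

lemma mul_mem_BplusA {x : A} (hx : x ∈ BplusA B) (a : A) : x * a ∈ BplusA B := by
  have : BplusA B ≤ (BplusA B).comap (LinearMap.mulRight ℂ a) := by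
    refine Submodule.span_le.2 ?_
    rintro _ ⟨b, c, hb, hε, rfl⟩
    exact Submodule.subset_span ⟨b, c * a, hb, hε, by simp [mul_assoc]⟩
  exact this hx

lemma counit_eq_zero_of_mem_BplusA {x : A} (hx : x ∈ BplusA B) :
    counit (R := ℂ) x = 0 := by
  have : BplusA B ≤ LinearMap.ker (counit (R := ℂ) (A := A)) := by
    refine Submodule.span_le.2 ?_
    rintro _ ⟨b, c, hb, hε, rfl⟩
    simp [hε]
  exact this hx

lemma mkQ_mul {b : A} (hb : b ∈ B) (a : A) :
    (BplusA B).mkQ (b * a) = counit (R := ℂ) b • (BplusA B).mkQ a := by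
  rw [← sub_eq_zero, ← map_smul, ← map_sub, Submodule.mkQ_apply,
    Submodule.Quotient.mk_eq_zero]
  refine Submodule.subset_span
    ⟨b - algebraMap ℂ A (counit b), a, B.sub_mem hb (B.algebraMap_mem _), ?_, ?_⟩
  · simp
  · rw [sub_mul, Algebra.smul_def]

lemma map_mkQ_comul_mul (hB : IsHopfSubalgebra B) {b : A} (hb : b ∈ B) (z : A ⊗[ℂ] A) :
    TensorProduct.map (BplusA B).mkQ (BplusA B).mkQ (comul (R := ℂ) b * z) =
      counit (R := ℂ) b • TensorProduct.map (BplusA B).mkQ (BplusA B).mkQ z := by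
  obtain ⟨w, hw⟩ := hB.1 b hb
  have key : ∀ w : B ⊗[ℂ] B,
      TensorProduct.map (BplusA B).mkQ (BplusA B).mkQ
        (TensorProduct.map B.val.toLinearMap B.val.toLinearMap w * z) =
      counit (R := ℂ) (TensorProduct.lid ℂ A (counit.rTensor A
        (TensorProduct.map B.val.toLinearMap B.val.toLinearMap w))) •
        TensorProduct.map (BplusA B).mkQ (BplusA B).mkQ z := by
    intro w
    induction w using TensorProduct.induction_on with
    | zero => simp
    | add x y hx hy => simp only [map_add, add_mul, add_smul, hx, hy]
    | tmul x y =>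
      induction z using TensorProduct.induction_on with
      | zero => simp
      | add u v hu hv => rw [mul_add, map_add, map_add, smul_add, hu, hv]
      | tmul u v =>
        simp only [TensorProduct.map_tmul, Algebra.TensorProduct.tmul_mul_tmul,
          AlgHom.toLinearMap_apply, Subalgebra.coe_val, mkQ_mul B x.2, mkQ_mul B y.2,
          LinearMap.rTensor_tmul, TensorProduct.lid_tmul, map_smul, smul_eq_mul,
          TensorProduct.smul_tmul_smul]
  rw [← hw, key, hw, rTensor_counit_comul, TensorProduct.lid_tmul, one_smul]

/-- The quotient `A / B⁺A`. -/
abbrev QuotBplusA : Type _ := A ⧸ BplusA B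

/-- Right multiplication on `A / B⁺A`. -/
noncomputable def right (a : A) : Module.End ℂ (QuotBplusA B) :=
  (BplusA B).mapQ (BplusA B) (LinearMap.mulRight ℂ a) fun _ hx ↦ mul_mem_BplusA B hx a

@[simp]
lemma right_mkQ (a x : A) : right B a ((BplusA B).mkQ x) = (BplusA B).mkQ (x * a) := rfl

/-- The comultiplication of `A / B⁺A`. -/
noncomputable def quotComul (hB : IsHopfSubalgebra B) :
    QuotBplusA B →ₗ[ℂ] QuotBplusA B ⊗[ℂ] QuotBplusA B :=
  (BplusA B).liftQ (TensorProduct.map (BplusA B).mkQ (BplusA B).mkQ ∘ₗ comul) <| by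
    refine Submodule.span_le.2 ?_
    rintro _ ⟨b, c, hb, hε, rfl⟩
    simp [map_mkQ_comul_mul B hB hb, hε]

/-- The counit of `A / B⁺A`. -/
noncomputable def quotCounit : Module.Dual ℂ (QuotBplusA B) :=
  (BplusA B).liftQ counit fun _ hx ↦ counit_eq_zero_of_mem_BplusA B hx

/-- The endomorphism `q ↦ f(q₁) q₂` of `A / B⁺A`, linearly in `f`. -/
noncomputable def hit (hB : IsHopfSubalgebra B) :
    Module.Dual ℂ (QuotBplusA B) →ₗ[ℂ] Module.End ℂ (QuotBplusA B) :=
  (LinearMap.lcomp ℂ (QuotBplusA B) (quotComul B hB)) ∘ₗ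
    (LinearMap.llcomp ℂ _ _ _ (TensorProduct.lid ℂ (QuotBplusA B)).toLinearMap) ∘ₗ
      LinearMap.rTensorHom (QuotBplusA B)

lemma hit_mkQ (hB : IsHopfSubalgebra B) (f : Module.Dual ℂ (QuotBplusA B)) (x : A) :
    hit B hB f ((BplusA B).mkQ x) =
      TensorProduct.lid ℂ (QuotBplusA B)
        (TensorProduct.map (f ∘ₗ (BplusA B).mkQ) (BplusA B).mkQ (comul (R := ℂ) x)) := by
  change TensorProduct.lid ℂ (QuotBplusA B) (f.rTensor (QuotBplusA B)
    (TensorProduct.map (BplusA B).mkQ (BplusA B).mkQ (comul (R := ℂ) x))) = _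
  rw [← LinearMap.comp_apply (LinearMap.rTensor _ f), LinearMap.rTensor_comp_map]

lemma hit_quotCounit (hB : IsHopfSubalgebra B) : hit B hB (quotCounit B) = 1 := by
  refine Submodule.linearMap_qext _ (LinearMap.ext fun x ↦ ?_)
  have h : quotCounit B ∘ₗ (BplusA B).mkQ = counit := Submodule.liftQ_mkQ _ _ _
  rw [LinearMap.comp_apply, hit_mkQ, h, ← LinearMap.lTensor_comp_rTensor,
    LinearMap.comp_apply, rTensor_counit_comul]
  simp

lemma hit_comp_right (hB : IsHopfSubalgebra B) (f : Module.Dual ℂ (QuotBplusA B))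
    {ι : Type*} {a : A} (r : Repr ℂ a ι) :
    hit B hB (f ∘ₗ right B a) =
      ∑ i ∈ r.index, right B (antipode ℂ (r.right i)) * (hit B hB f * right B (r.left i)) := by
  set Φ : A ⊗[ℂ] A →ₗ[ℂ] QuotBplusA B := (TensorProduct.lid ℂ (QuotBplusA B)).toLinearMap ∘ₗ
    TensorProduct.map (f ∘ₗ (BplusA B).mkQ) (BplusA B).mkQ with hΦ
  have h₁ : ∀ x, hit B hB f ((BplusA B).mkQ x) = Φ (comul x) := hit_mkQ B hB f
  have h₂ : ∀ s z, right B s (Φ z) = Φ (z * ((1 : A) ⊗ₜ[ℂ] s)) := by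
    intro s z
    induction z using TensorProduct.induction_on with
    | zero => simp
    | add u v hu hv => simp only [map_add, add_mul, hu, hv]
    | tmul u v => simp [hΦ, - Submodule.mkQ_apply]
  have h₃ : ∀ z, TensorProduct.lid ℂ (QuotBplusA B)
      (TensorProduct.map ((f ∘ₗ right B a) ∘ₗ (BplusA B).mkQ) (BplusA B).mkQ z) =
        Φ (z * (a ⊗ₜ[ℂ] (1 : A))) := by
    intro z
    induction z using TensorProduct.induction_on with
    | zero => simp
    | add u v hu hv => simp only [map_add, add_mul, hu, hv]
    | tmul u v => simp [hΦ, - Submodule.mkQ_apply]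
  refine Submodule.linearMap_qext _ (LinearMap.ext fun x ↦ ?_)
  simp only [LinearMap.comp_apply, LinearMap.sum_apply, Module.End.mul_apply, right_mkQ, h₁, h₂]
  rw [hit_mkQ, h₃, ← sum_comul_mul_one_tmul_antipode r, Finset.mul_sum, map_sum]
  simp only [Bialgebra.comul_mul, mul_assoc]

lemma trace_hit_comp_right (hS : ∀ a : A, antipode ℂ (antipode ℂ a) = a)
    (hB : IsHopfSubalgebra B) (f : Module.Dual ℂ (QuotBplusA B)) (a : A) :
    LinearMap.trace ℂ (QuotBplusA B) (hit B hB (f ∘ₗ right B a)) =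
      counit (R := ℂ) a * LinearMap.trace ℂ (QuotBplusA B) (hit B hB f) := by
  have h : ∑ i ∈ (ℛ ℂ a).index,
      right B ((ℛ ℂ a).left i) * right B (antipode ℂ ((ℛ ℂ a).right i)) =
        counit (R := ℂ) a • 1 := by
    refine Submodule.linearMap_qext _ (LinearMap.ext fun x ↦ ?_)
    simp only [LinearMap.comp_apply, LinearMap.sum_apply, Module.End.mul_apply, right_mkQ,
      mul_assoc]
    rw [← map_sum, ← Finset.mul_sum, sum_antipode_right_mul_left hS]
    simp
  rw [hit_comp_right B hB f (ℛ ℂ a), map_sum]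
  simp_rw [LinearMap.trace_mul_comm ℂ (right B (antipode ℂ _)), mul_assoc]
  rw [← map_sum, ← Finset.mul_sum, h]
  simp

lemma finite_quot [Module.Finite B A] : Module.Finite ℂ (QuotBplusA B) := by
  obtain ⟨s, hs⟩ := Module.Finite.fg_top (R := B) (M := A)
  classical
  refine ⟨⟨s.image (BplusA B).mkQ, eq_top_iff.2 fun q _ ↦ ?_⟩⟩
  obtain ⟨x, rfl⟩ := (BplusA B).mkQ_surjective q
  have hx : x ∈ Submodule.span B (s : Set A) := hs ▸ Submodule.mem_top
  induction hx using Submodule.span_induction with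
  | mem y hy => exact Submodule.subset_span (by simpa using ⟨y, hy, rfl⟩)
  | zero => simp
  | add y z _ _ hy hz => rw [map_add]; exact Submodule.add_mem _ (hy trivial) (hz trivial)
  | smul b y _ hy =>
    rw [Subalgebra.smul_def, smul_eq_mul, mkQ_mul B b.2]
    exact Submodule.smul_mem _ _ (hy trivial)

lemma nontrivial_quot : Nontrivial (QuotBplusA B) := by
  refine ⟨(BplusA B).mkQ 1, 0, fun h ↦ ?_⟩
  have h := counit_eq_zero_of_mem_BplusA B ((Submodule.Quotient.mk_eq_zero _).1 h)
  simp at h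

end RelativeIntegral

/-- Proposition 3.11(1): let `A` be a Hopf algebra of Kac type
(`S² = id`) and `B ⊆ A` a Hopf subalgebra with `A` finitely generated as a left
`B`-module. Then there exists a right `A/B`-integral `t` with `ε(t) ≠ 0`. -/
theorem exists_integral_of_kac {A : Type*} [Ring A] [HopfAlgebra ℂ A]
    (hKac : ∀ a : A,
      HopfAlgebra.antipode (R := ℂ) (HopfAlgebra.antipode (R := ℂ) a) = a)
    (B : Subalgebra ℂ A) (hB : IsHopfSubalgebra B)
    (hfin : Module.Finite ↥B A) :
    ∃ t : A, Coalgebra.counit (R := ℂ) t ≠ 0 ∧ IsRightRelIntegral B t := by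
  have := RelativeIntegral.finite_quot B
  have := RelativeIntegral.nontrivial_quot B
  obtain ⟨q, hq⟩ := (Module.evalEquiv ℂ (RelativeIntegral.QuotBplusA B)).surjective
    (LinearMap.trace ℂ (RelativeIntegral.QuotBplusA B) ∘ₗ RelativeIntegral.hit B hB)
  have hq' (f : Module.Dual ℂ (RelativeIntegral.QuotBplusA B)) :
      f q = LinearMap.trace ℂ (RelativeIntegral.QuotBplusA B) (RelativeIntegral.hit B hB f) :=
    LinearMap.congr_fun hq f
  obtain ⟨t, rfl⟩ := (BplusA B).mkQ_surjective q
  refine ⟨t, ?_, fun a ↦ ?_⟩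
  · have h := hq' (RelativeIntegral.quotCounit B)
    rw [RelativeIntegral.hit_quotCounit, LinearMap.trace_one] at h
    have h' : Coalgebra.counit (R := ℂ) t =
        (Module.finrank ℂ (RelativeIntegral.QuotBplusA B) : ℂ) := h
    rw [h', Nat.cast_ne_zero]
    exact Module.finrank_pos.ne'
  · rw [← Submodule.Quotient.mk_eq_zero, ← Submodule.mkQ_apply, map_sub, map_smul, sub_eq_zero,
      ← RelativeIntegral.right_mkQ, ← sub_eq_zero, ← Module.forall_dual_apply_eq_zero_iff ℂ]
    intro f
    rw [map_sub, map_smul, smul_eq_mul, hq' f, sub_eq_zero,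
      ← RelativeIntegral.trace_hit_comp_right B hKac hB f a]
    exact hq' (f ∘ₗ RelativeIntegral.right B a)
end

section
/- Let A be the unital ℂ-algebra presented by generators x, g, h and relations gh = 1 = hg, x² = 0, xg = −gx, let ε : A → ℂ be the algebra map determined by ε(g) = ε(h) = 1 and ε(x) = 0, and let B ⊆ A be the subalgebra generated by g and h. Then the quotient vector space A/B⁺A is 2-dimensional over ℂ, and every t ∈ A satisfying ta − ε(a)t ∈ B⁺A for all a ∈ A lies in B⁺A; that is, there is no non-trivial right A/B-integral. -/
/-- The relations presenting the algebra
`A = ℂ⟨x, g, h | gh = 1 = hg, x² = 0, xg = −gx⟩` (generator `0` is `x`, generator `1` is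
`g`, generator `2` is `h = g⁻¹`). -/
inductive ExRel : FreeAlgebra ℂ (Fin 3) → FreeAlgebra ℂ (Fin 3) → Prop
  | gh : ExRel (FreeAlgebra.ι ℂ (1 : Fin 3) * FreeAlgebra.ι ℂ (2 : Fin 3)) 1
  | hg : ExRel (FreeAlgebra.ι ℂ (2 : Fin 3) * FreeAlgebra.ι ℂ (1 : Fin 3)) 1
  | xsq : ExRel (FreeAlgebra.ι ℂ (0 : Fin 3) * FreeAlgebra.ι ℂ (0 : Fin 3)) 0
  | xg : ExRel (FreeAlgebra.ι ℂ (0 : Fin 3) * FreeAlgebra.ι ℂ (1 : Fin 3))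
      (-(FreeAlgebra.ι ℂ (1 : Fin 3) * FreeAlgebra.ι ℂ (0 : Fin 3)))

/-- The algebra `A = ℂ⟨x, g, h | gh = 1 = hg, x² = 0, xg = −gx⟩`. -/
abbrev ExAlg := RingQuot ExRel

/-- The generator `x`. -/
noncomputable def exX : ExAlg := RingQuot.mkAlgHom ℂ ExRel (FreeAlgebra.ι ℂ 0)

/-- The generator `g`. -/
noncomputable def exG : ExAlg := RingQuot.mkAlgHom ℂ ExRel (FreeAlgebra.ι ℂ 1)

/-- The generator `h = g⁻¹`. -/
noncomputable def exH : ExAlg := RingQuot.mkAlgHom ℂ ExRel (FreeAlgebra.ι ℂ 2)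

/-- The algebra map `ε : A → ℂ` with `ε(g) = ε(h) = 1` and `ε(x) = 0`. -/
noncomputable def exEps : ExAlg →ₐ[ℂ] ℂ :=
  RingQuot.liftAlgHom ℂ
    ⟨FreeAlgebra.lift ℂ (fun i => if i = 0 then (0 : ℂ) else 1), by
      intro a b h
      induction h with
      | gh => simp [FreeAlgebra.lift_ι_apply]
      | hg => simp [FreeAlgebra.lift_ι_apply]
      | xsq => simp [FreeAlgebra.lift_ι_apply]
      | xg => simp [FreeAlgebra.lift_ι_apply]⟩

/-- The subalgebra `B = ℂ[g, g⁻¹]` of `A`. -/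
noncomputable def exB : Subalgebra ℂ ExAlg := Algebra.adjoin ℂ {exG, exH}

/-- The subspace `B⁺A ⊆ A`. -/
noncomputable def exBplusA : Submodule ℂ ExAlg :=
  Submodule.span ℂ {z : ExAlg | ∃ b a : ExAlg, b ∈ exB ∧ exEps b = 0 ∧ z = b * a}

/-- The right action of `A` on `A / B⁺A` in the basis given by the classes of `1` and `x`,
as matrices acting on row vectors. -/
noncomputable def exRep : ExAlg →ₐ[ℂ] Matrix (Fin 2) (Fin 2) ℂ :=
  RingQuot.liftAlgHom ℂ
    ⟨FreeAlgebra.lift ℂ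
      (fun i => if i = 0 then !![0, 1; 0, 0] else !![1, 0; 0, -1]), by
      intro a b h
      induction h <;> ext i j <;> fin_cases i <;> fin_cases j <;>
        simp [FreeAlgebra.lift_ι_apply]⟩

@[simp] lemma exRep_exX : exRep exX = !![0, 1; 0, 0] := by
  simp [exRep, exX]

@[simp] lemma exRep_exG : exRep exG = !![1, 0; 0, -1] := by
  simp [exRep, exG]

@[simp] lemma exRep_exH : exRep exH = !![1, 0; 0, -1] := by
  simp [exRep, exH]

@[simp] lemma exEps_exX : exEps exX = 0 := by
  simp [exEps, exX]

@[simp] lemma exEps_exG : exEps exG = 1 := by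
  simp [exEps, exG]

@[simp] lemma exEps_exH : exEps exH = 1 := by
  simp [exEps, exH]

lemma exG_mul_exH : exG * exH = 1 := by
  simpa [exG, exH] using RingQuot.mkAlgHom_rel ℂ ExRel.gh

lemma exH_mul_exG : exH * exG = 1 := by
  simpa [exG, exH] using RingQuot.mkAlgHom_rel ℂ ExRel.hg

lemma exX_mul_exX : exX * exX = 0 := by
  simpa [exX] using RingQuot.mkAlgHom_rel ℂ ExRel.xsq

lemma exX_mul_exG : exX * exG = -(exG * exX) := by
  simpa [exX, exG] using RingQuot.mkAlgHom_rel ℂ ExRel.xg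

lemma exX_mul_exH : exX * exH = -(exH * exX) := by
  refine eq_neg_of_add_eq_zero_left ?_
  calc exX * exH + exH * exX
      = exH * exG * (exX * exH) + exH * exX * (exG * exH) := by
        rw [exH_mul_exG, exG_mul_exH, one_mul, mul_one]
    _ = exH * (exG * exX + exX * exG) * exH := by
        simp only [mul_add, add_mul, mul_assoc]
    _ = 0 := by rw [exX_mul_exG, add_neg_cancel, mul_zero, zero_mul]

/-- The first row of the representation, which induces `A / B⁺A ≃ ℂ²`. -/
noncomputable def exRow : ExAlg →ₗ[ℂ] (Fin 2 → ℂ) where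
  toFun a := exRep a 0
  map_add' a b := by rw [map_add]; rfl
  map_smul' c a := by rw [map_smul]; rfl

lemma exRow_apply (a : ExAlg) : exRow a = exRep a 0 := rfl

lemma exRow_mul (a b : ExAlg) : exRow (a * b) = Matrix.vecMul (exRow a) (exRep b) := by
  ext j
  simp [exRow_apply, Matrix.mul_apply, Matrix.vecMul, dotProduct]

lemma exRow_of_mem_exB {b : ExAlg} (hb : b ∈ exB) : exRow b = ![exEps b, 0] := by
  induction hb using Algebra.adjoin_induction with
  | mem b hb =>
    rcases hb with rfl | rfl <;> ext j <;> fin_cases j <;> simp [exRow_apply]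
  | algebraMap c =>
    ext j; fin_cases j <;> simp [exRow_apply, Matrix.algebraMap_matrix_apply]
  | add a b _ _ ha hb => simp [ha, hb]
  | mul a b _ _ ha hb =>
    rw [exRow_mul, ha]
    have h := congrArg (exEps a • ·) hb
    ext j
    have hj := congrFun h j
    fin_cases j <;> simpa [exRow_apply, Matrix.vecMul, dotProduct] using hj

lemma exBplusA_le_ker : exBplusA ≤ LinearMap.ker exRow := by
  refine Submodule.span_le.2 ?_
  rintro _ ⟨b, a, hb, he, rfl⟩
  rw [SetLike.mem_coe, LinearMap.mem_ker, exRow_mul, exRow_of_mem_exB hb, he]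
  ext j
  simp [Matrix.vecMul, dotProduct]

lemma mul_mem_exBplusA {z : ExAlg} (hz : z ∈ exBplusA) (c : ExAlg) : z * c ∈ exBplusA := by
  induction hz using Submodule.span_induction with
  | mem z hz =>
    obtain ⟨b, a, hb, he, rfl⟩ := hz
    exact Submodule.subset_span ⟨b, a * c, hb, he, mul_assoc _ _ _⟩
  | zero => simp
  | add y z _ _ hy hz => rw [add_mul]; exact add_mem hy hz
  | smul r z _ hz => rw [smul_mul_assoc]; exact Submodule.smul_mem _ _ hz

lemma exG_sub_one_mul_mem (a : ExAlg) : (exG - 1) * a ∈ exBplusA :=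
  Submodule.subset_span
    ⟨_, a, sub_mem (Algebra.subset_adjoin (by simp)) (one_mem _), by simp, rfl⟩

lemma exH_sub_one_mul_mem (a : ExAlg) : (exH - 1) * a ∈ exBplusA :=
  Submodule.subset_span
    ⟨_, a, sub_mem (Algebra.subset_adjoin (by simp)) (one_mem _), by simp, rfl⟩

lemma exAlg_induction {P : ExAlg → Prop} (algebraMap : ∀ c, P (algebraMap ℂ ExAlg c))
    (x : P exX) (g : P exG) (h : P exH) (add : ∀ a b, P a → P b → P (a + b))
    (mul : ∀ a b, P a → P b → P (a * b)) (a : ExAlg) : P a := by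
  obtain ⟨w, rfl⟩ := RingQuot.mkAlgHom_surjective ℂ ExRel a
  induction w using FreeAlgebra.induction with
  | grade0 c => rw [AlgHom.commutes]; exact algebraMap c
  | grade1 i => fin_cases i <;> assumption
  | mul a b ha hb => rw [map_mul]; exact mul _ _ ha hb
  | add a b ha hb => rw [map_add]; exact add _ _ ha hb

/-- Modulo `B⁺A`, right multiplication on the classes of `1` and `x` is given by `exRep`. -/
lemma sub_exRep_mem_exBplusA (a : ExAlg) :
    a - (exRep a 0 0 • 1 + exRep a 0 1 • exX) ∈ exBplusA ∧
      exX * a - (exRep a 1 0 • 1 + exRep a 1 1 • exX) ∈ exBplusA := by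
  induction a using exAlg_induction with
  | algebraMap c =>
    simp [Algebra.algebraMap_eq_smul_one]
  | x => simp [exX_mul_exX]
  | g =>
    refine ⟨by simpa using exG_sub_one_mul_mem 1, ?_⟩
    convert neg_mem (exG_sub_one_mul_mem exX) using 1
    simp [exX_mul_exG, sub_mul]
    module
  | h =>
    refine ⟨by simpa using exH_sub_one_mul_mem 1, ?_⟩
    convert neg_mem (exH_sub_one_mul_mem exX) using 1
    simp [exX_mul_exH, sub_mul]
    module
  | add a b ha hb =>
    constructor
    · convert add_mem ha.1 hb.1 using 1
      simp only [map_add, Matrix.add_apply]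
      module
    · convert add_mem ha.2 hb.2 using 1
      simp only [map_add, Matrix.add_apply, mul_add]
      module
  | mul a b ha hb =>
    have key (y : ExAlg) (p q : ℂ) (hy : y - (p • 1 + q • exX) ∈ exBplusA) :
        y * b - ((p * exRep b 0 0 + q * exRep b 1 0) • 1 +
          (p * exRep b 0 1 + q * exRep b 1 1) • exX) ∈ exBplusA := by
      convert add_mem (mul_mem_exBplusA hy b) (add_mem (Submodule.smul_mem _ p hb.1)
        (Submodule.smul_mem _ q hb.2)) using 1
      simp only [sub_mul, add_mul, smul_mul_assoc, one_mul]
      module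
    simp only [map_mul, Matrix.mul_apply, Fin.sum_univ_two, ← mul_assoc]
    exact ⟨key _ _ _ ha.1, key _ _ _ ha.2⟩

lemma exBplusA_eq_ker : exBplusA = LinearMap.ker exRow := by
  refine le_antisymm exBplusA_le_ker fun a ha => ?_
  rw [LinearMap.mem_ker, exRow_apply] at ha
  simpa [ha] using (sub_exRep_mem_exBplusA a).1

lemma exRow_surjective : Function.Surjective exRow := by
  intro v
  refine ⟨v 0 • 1 + v 1 • exX, ?_⟩
  ext j
  fin_cases j <;> simp [exRow_apply]

/-- The example of Section 3: for
`A = ℂ⟨x, g, g⁻¹ | x² = 0, xg = −gx⟩` and `B = ℂ[g, g⁻¹]`, the quotient `A/B⁺A` is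
2-dimensional, yet every right `A/B`-integral is trivial (lies in `B⁺A`). -/
theorem no_nontrivial_integral :
    Module.finrank ℂ (ExAlg ⧸ exBplusA) = 2
    ∧ ∀ t : ExAlg, (∀ a : ExAlg, t * a - exEps a • t ∈ exBplusA) → t ∈ exBplusA := by
  rw [exBplusA_eq_ker]
  refine ⟨?_, fun t ht => ?_⟩
  · rw [(exRow.quotKerEquivOfSurjective exRow_surjective).finrank_eq, Module.finrank_fin_fun]
  · have hx := congrFun (LinearMap.mem_ker.1 (ht exX)) 1
    have hg := congrFun (LinearMap.mem_ker.1 (ht exG)) 1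
    simp [exRow_mul, Matrix.vecMul, dotProduct, Matrix.vecHead, Matrix.vecTail] at hx hg
    rw [LinearMap.mem_ker]
    ext j
    fin_cases j
    · simpa using hx
    · simp only [Fin.mk_one, Pi.zero_apply]
      linear_combination (-1 / 2) * hg
end

section
/- Let A be a Hopf algebra over ℂ and B ⊆ A a Hopf subalgebra such that A is finitely generated and projective as a right B-module. Then for every n ∈ ℕ, the trivial right A-module ℂ_ε is of type FP_n over A if and only if the trivial right B-module ℂ_{ε|B} is of type FP_n over B; consequently the same holds for type FP_∞. -/
open MulOpposite

universe u

section FinitenessType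

variable {R : Type u} [Ring R]

/-- A short exact sequence with projective last term splits. -/
theorem Function.Exact.nonempty_equiv_prod {K X P : Type*} [AddCommGroup K] [Module R K]
    [AddCommGroup X] [Module R X] [AddCommGroup P] [Module R P] [Module.Projective R P]
    {f : K →ₗ[R] X} {g : X →ₗ[R] P} (h : Function.Exact f g) (hf : Function.Injective f)
    (hg : Function.Surjective g) : Nonempty (X ≃ₗ[R] K × P) := by
  obtain ⟨s, hs⟩ := g.exists_rightInverse_of_surjective (LinearMap.range_eq_top.2 hg)
  exact ⟨(h.splitSurjectiveEquiv hf ⟨s, hs⟩).1⟩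

theorem LinearMap.nonempty_equiv_ker_prod {X P : Type*} [AddCommGroup X] [Module R X]
    [AddCommGroup P] [Module R P] [Module.Projective R P] {g : X →ₗ[R] P}
    (hg : Function.Surjective g) : Nonempty (X ≃ₗ[R] LinearMap.ker g × P) :=
  Function.Exact.nonempty_equiv_prod (LinearMap.exact_subtype_ker_map g)
    (Submodule.subtype_injective _) hg

theorem LinearMap.finite_ker_of_projective {X P : Type*} [AddCommGroup X] [Module R X]
    [AddCommGroup P] [Module R P] [Module.Projective R P] [Module.Finite R X] {g : X →ₗ[R] P}
    (hg : Function.Surjective g) : Module.Finite R (LinearMap.ker g) := by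
  obtain ⟨e⟩ := LinearMap.nonempty_equiv_ker_prod hg
  exact Module.Finite.of_surjective (LinearMap.fst R _ P ∘ₗ e.toLinearMap)
    (Prod.fst_surjective.comp e.surjective)

theorem LinearMap.projective_ker_of_projective {X P : Type*} [AddCommGroup X] [Module R X]
    [AddCommGroup P] [Module R P] [Module.Projective R P] [Module.Projective R X]
    {g : X →ₗ[R] P} (hg : Function.Surjective g) : Module.Projective R (LinearMap.ker g) := by
  obtain ⟨e⟩ := LinearMap.nonempty_equiv_ker_prod hg
  refine Module.Projective.of_split (e.symm.toLinearMap ∘ₗ LinearMap.inl R _ P)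
    (LinearMap.fst R _ P ∘ₗ e.toLinearMap) ?_
  ext x
  simp

/-- The kernel of a composition `f ∘ g` with `g` onto a projective module splits as
`ker f × ker g`. -/
theorem LinearMap.nonempty_ker_comp_equiv {X P M : Type*} [AddCommGroup X] [Module R X]
    [AddCommGroup P] [Module R P] [AddCommGroup M] [Module R M] [Module.Projective R P]
    {g : X →ₗ[R] P} (hg : Function.Surjective g) (f : P →ₗ[R] M) :
    Nonempty (LinearMap.ker (f ∘ₗ g) ≃ₗ[R] LinearMap.ker f × LinearMap.ker g) := by
  obtain ⟨s, hs⟩ := g.exists_rightInverse_of_surjective (LinearMap.range_eq_top.2 hg)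
  replace hs : ∀ p, g (s p) = p := fun p => LinearMap.congr_fun hs p
  let i : LinearMap.ker f →ₗ[R] LinearMap.ker (f ∘ₗ g) :=
    (s.domRestrict _).codRestrict _ fun x => by simp [hs]
  let j : LinearMap.ker g →ₗ[R] LinearMap.ker (f ∘ₗ g) :=
    Submodule.inclusion (LinearMap.ker_le_ker_comp g f)
  have hi : ∀ x, (i x : X) = s x := fun _ => rfl
  have hj : ∀ x, (j x : X) = x := fun _ => rfl
  refine ⟨(LinearEquiv.ofBijective (i.coprod j) ⟨?_, ?_⟩).symm⟩
  · rw [injective_iff_map_eq_zero]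
    rintro ⟨x, y⟩ hxy
    have h1 : s x + (y : X) = 0 := congrArg Subtype.val hxy
    have h2 : (x : P) = 0 := by simpa [hs] using congrArg g h1
    have h3 : (y : X) = 0 := by simpa [h2] using h1
    exact Prod.ext (Subtype.ext h2) (Subtype.ext h3)
  · rintro ⟨x, hx⟩
    refine ⟨(⟨g x, by simpa using hx⟩, ⟨x - s (g x), by simp [hs]⟩), Subtype.ext ?_⟩
    simp [hi, hj]

/-- Schanuel's lemma. -/
theorem LinearMap.nonempty_ker_prod_equiv_ker_prod {P Q M : Type*} [AddCommGroup P] [Module R P]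
    [AddCommGroup Q] [Module R Q] [AddCommGroup M] [Module R M] [Module.Projective R P]
    [Module.Projective R Q] {f : P →ₗ[R] M} {g : Q →ₗ[R] M} (hf : Function.Surjective f)
    (hg : Function.Surjective g) :
    Nonempty ((LinearMap.ker f × Q) ≃ₗ[R] LinearMap.ker g × P) := by
  let E := LinearMap.ker (f ∘ₗ LinearMap.fst R P Q - g ∘ₗ LinearMap.snd R P Q)
  have mem : ∀ x : P × Q, x ∈ E ↔ f x.1 = g x.2 := fun x => by simp [E, sub_eq_zero]
  have hE : ∀ x : E, f (x : P × Q).1 = g (x : P × Q).2 := fun x => (mem x).1 x.2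
  let i : LinearMap.ker f →ₗ[R] E :=
    (LinearMap.inl R P Q ∘ₗ (LinearMap.ker f).subtype).codRestrict _ fun x => by simp [mem]
  let j : LinearMap.ker g →ₗ[R] E :=
    (LinearMap.inr R P Q ∘ₗ (LinearMap.ker g).subtype).codRestrict _ fun x => by simp [mem]
  obtain ⟨e₁⟩ := Function.Exact.nonempty_equiv_prod (f := i)
    (g := LinearMap.snd R P Q ∘ₗ E.subtype)
    (fun x => ⟨fun hx => by
      have hx : (x : P × Q).2 = 0 := hx
      exact ⟨⟨(x : P × Q).1, by simp [hE, hx]⟩, Subtype.ext (Prod.ext rfl hx.symm)⟩, by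
        rintro ⟨y, rfl⟩; rfl⟩)
    (fun x y h => Subtype.ext (congrArg (fun z : E => (z : P × Q).1) h))
    (fun q => by
      obtain ⟨p, hp⟩ := hf (g q)
      exact ⟨⟨(p, q), by simp [mem, hp]⟩, rfl⟩)
  obtain ⟨e₂⟩ := Function.Exact.nonempty_equiv_prod (f := j)
    (g := LinearMap.fst R P Q ∘ₗ E.subtype)
    (fun x => ⟨fun hx => by
      have hx : (x : P × Q).1 = 0 := hx
      exact ⟨⟨(x : P × Q).2, by simp [← hE, hx]⟩, Subtype.ext (Prod.ext hx.symm rfl)⟩, by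
        rintro ⟨y, rfl⟩; rfl⟩)
    (fun x y h => Subtype.ext (congrArg (fun z : E => (z : P × Q).2) h))
    (fun p => by
      obtain ⟨q, hq⟩ := hg (f p)
      exact ⟨⟨(p, q), by simp [mem, hq]⟩, rfl⟩)
  exact ⟨e₁.symm.trans e₂⟩

variable {M N : Type u} [AddCommGroup M] [Module R M] [AddCommGroup N] [Module R N]

theorem FPn.of_equiv {n : ℕ} (e : M ≃ₗ[R] N) (h : FPn R n M) : FPn R n N := by
  cases n with
  | zero =>
    have : Module.Finite R M := h
    exact Module.Finite.equiv e
  | succ n =>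
    obtain ⟨k, f, hf, hK⟩ := h
    refine ⟨k, e.toLinearMap ∘ₗ f, e.surjective.comp hf, ?_⟩
    rwa [LinearEquiv.ker_comp]

theorem FPn.finite {n : ℕ} (h : FPn R n M) : Module.Finite R M := by
  cases n with
  | zero => exact h
  | succ n =>
    obtain ⟨k, f, hf, -⟩ := h
    exact Module.Finite.of_surjective f hf

theorem FPn.prod {n : ℕ} {Q : Type u} [AddCommGroup Q] [Module R Q] [Module.Finite R Q]
    [Module.Projective R Q] (h : FPn R n M) : FPn R n (M × Q) := by
  induction n generalizing M Q with
  | zero =>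
    have : Module.Finite R M := h
    exact inferInstanceAs (Module.Finite R (M × Q))
  | succ n ih =>
    obtain ⟨k, f, hf, hK⟩ := h
    obtain ⟨m, g, hg⟩ := Module.Finite.exists_fin' R Q
    have := LinearMap.finite_ker_of_projective hg
    have := LinearMap.projective_ker_of_projective hg
    let e : (Fin (k + m) → R) ≃ₗ[R] (Fin k → R) × (Fin m → R) :=
      (LinearEquiv.funCongrLeft R R finSumFinEquiv).trans
        (LinearEquiv.sumArrowLequivProdArrow (Fin k) (Fin m) R R)
    refine ⟨k + m, f.prodMap g ∘ₗ e.toLinearMap, (hf.prodMap hg).comp e.surjective, ?_⟩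
    let e' : (LinearMap.ker f × LinearMap.ker g) ≃ₗ[R] LinearMap.ker (f.prodMap g) :=
      { toFun x := ⟨(x.1, x.2), by simp⟩
        invFun x := (⟨x.1.1, congrArg Prod.fst x.2⟩, ⟨x.1.2, congrArg Prod.snd x.2⟩)
        map_add' _ _ := rfl
        map_smul' _ _ := rfl
        left_inv _ := rfl
        right_inv _ := rfl }
    exact (ih hK (Q := LinearMap.ker g)).of_equiv
      (e'.trans (LinearEquiv.ofSubmodule' e (LinearMap.ker (f.prodMap g))).symm)

theorem FPn.of_prod {n : ℕ} {Q : Type u} [AddCommGroup Q] [Module R Q] [Module.Finite R Q]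
    [Module.Projective R Q] (h : FPn R n (M × Q)) : FPn R n M := by
  cases n with
  | zero =>
    have : Module.Finite R (M × Q) := h
    exact Module.Finite.of_surjective (LinearMap.fst R M Q) LinearMap.fst_surjective
  | succ n =>
    obtain ⟨k, f, hf, hK⟩ := h
    refine ⟨k, LinearMap.fst R M Q ∘ₗ f, Prod.fst_surjective.comp hf, ?_⟩
    obtain ⟨e⟩ := Function.Exact.nonempty_equiv_prod
      (f := Submodule.inclusion (LinearMap.ker_le_ker_comp f (LinearMap.fst R M Q)))
      (g := LinearMap.snd R M Q ∘ₗ f ∘ₗ (LinearMap.ker (LinearMap.fst R M Q ∘ₗ f)).subtype)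
      (fun x => ⟨fun hx => ⟨⟨x, Prod.ext x.2 hx⟩, rfl⟩, by
        rintro ⟨y, rfl⟩
        exact congrArg Prod.snd y.2⟩)
      (Submodule.inclusion_injective _)
      (fun q => by
        obtain ⟨x, hx⟩ := hf (0, q)
        exact ⟨⟨x, congrArg Prod.fst hx⟩, congrArg Prod.snd hx⟩)
    exact (hK.prod (Q := Q)).of_equiv e.symm

/-- A module is of type `FP_{n+1}` if and only if the kernel of any surjection from a finitely
generated projective module onto it is of type `FP_n`. -/
theorem FPn.succ_iff_ker {n : ℕ} {P : Type u} [AddCommGroup P] [Module R P] [Module.Finite R P]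
    [Module.Projective R P] {f : P →ₗ[R] M} (hf : Function.Surjective f) :
    FPn R (n + 1) M ↔ FPn R n (LinearMap.ker f) := by
  constructor
  · rintro ⟨k, g, hg, hK⟩
    obtain ⟨e⟩ := LinearMap.nonempty_ker_prod_equiv_ker_prod hg hf
    exact ((hK.prod (Q := P)).of_equiv e).of_prod
  · intro hK
    obtain ⟨m, g, hg⟩ := Module.Finite.exists_fin' R P
    have := LinearMap.finite_ker_of_projective hg
    have := LinearMap.projective_ker_of_projective hg
    obtain ⟨e⟩ := LinearMap.nonempty_ker_comp_equiv hg f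
    exact ⟨m, f ∘ₗ g, hf.comp hg, (hK.prod (Q := LinearMap.ker g)).of_equiv e.symm⟩

/-- Along a ring extension which is finitely generated projective over the base, the property
of being of type `FP_n` can be tested after restriction of scalars. -/
theorem FPn.restrictScalars_iff (R : Type u) [Ring R] {S : Type u} [Ring S] [Module R S]
    [IsScalarTower R S S] [Module.Finite R S] [Module.Projective R S] {n : ℕ} {M : Type u}
    [AddCommGroup M] [Module R M] [Module S M] [IsScalarTower R S M] :
    FPn S n M ↔ FPn R n M := by
  induction n generalizing M with
  | zero =>
    constructor <;> intro h
    · have : Module.Finite S M := h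
      exact Module.Finite.trans S M
    · have : Module.Finite R M := h
      exact Module.Finite.of_restrictScalars_finite R S M
  | succ n ih =>
    have key : ∀ (k : ℕ) (f : (Fin k → S) →ₗ[S] M), Function.Surjective f →
        (FPn S n (LinearMap.ker f) ↔ FPn R (n + 1) M) := by
      intro k f hf
      have : Module.Projective R (Fin k → S) :=
        Module.Projective.of_equiv (DFinsupp.linearEquivFunOnFintype (R := R) (M := fun _ : Fin k => S))
      have : Module.Finite R (Fin k → S) := Module.Finite.trans S _
      rw [FPn.succ_iff_ker (f := f.restrictScalars R) hf]
      exact ih (M := LinearMap.ker f)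
    constructor
    · rintro ⟨k, f, hf, hK⟩
      exact (key k f hf).1 hK
    · intro h
      have := h.finite
      have : Module.Finite S M := Module.Finite.of_restrictScalars_finite R S M
      obtain ⟨k, f, hf⟩ := Module.Finite.exists_fin' S M
      exact ⟨k, f, hf, (key k f hf).2 h⟩

end FinitenessType

/-- The right `B`-module structure on `A`, as a left `Bᵐᵒᵖ`-module structure on `Aᵐᵒᵖ`. -/
abbrev Subalgebra.opModule {A : Type*} [Ring A] [Algebra ℂ A] (B : Subalgebra ℂ A) :
    Module (↥B)ᵐᵒᵖ Aᵐᵒᵖ :=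
  Module.compHom Aᵐᵒᵖ (RingHom.op B.val.toRingHom)

theorem FGProjRight.finite_and_projective {A : Type*} [Ring A] [Algebra ℂ A]
    {B : Subalgebra ℂ A} (h : FGProjRight B) :
    letI := B.opModule
    Module.Finite (↥B)ᵐᵒᵖ Aᵐᵒᵖ ∧ Module.Projective (↥B)ᵐᵒᵖ Aᵐᵒᵖ := by
  let := B.opModule
  have hsmul : ∀ (b : (↥B)ᵐᵒᵖ) (a : Aᵐᵒᵖ), b • a = op (unop a * ↑(unop b)) := fun _ _ => rfl
  obtain ⟨k, x, f, hf, hx⟩ := h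
  let i : Aᵐᵒᵖ →ₗ[(↥B)ᵐᵒᵖ] (Fin k → (↥B)ᵐᵒᵖ) :=
    { toFun a j := op (f j (unop a))
      map_add' a a' := by ext; simp
      map_smul' b a := by
        funext j
        exact congrArg op (hf j (unop a) (unop b)) }
  let s : (Fin k → (↥B)ᵐᵒᵖ) →ₗ[(↥B)ᵐᵒᵖ] Aᵐᵒᵖ :=
    Fintype.linearCombination (↥B)ᵐᵒᵖ fun j => op (x j)
  have hs : ∀ a, s (i a) = a := fun a => by
    apply unop_injective
    simp only [s, i, Fintype.linearCombination_apply, LinearMap.coe_mk, AddHom.coe_mk, hsmul,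
      unop_op, Finset.unop_sum]
    exact (hx _).symm
  exact ⟨Module.Finite.of_surjective s fun a => ⟨_, hs a⟩,
    Module.Projective.of_split i s (LinearMap.ext hs)⟩

/-- Proposition 3.9: let `A` be a Hopf algebra over `ℂ` and `B ⊆ A` a
Hopf subalgebra with `A` finitely generated and projective as a right `B`-module. Then for
every `n`, the trivial right `A`-module `ℂ_ε` is of type `FP_n` over `A` if and only if
the trivial right `B`-module is of type `FP_n` over `B` (hence the same holds for
type `FP_∞`). -/
theorem trivial_module_FPn_iff (A : Type) [Ring A] [HopfAlgebra ℂ A]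
    (B : Subalgebra ℂ A) (hB : IsHopfSubalgebra B)
    (hproj : FGProjRight B) :
    ∀ n : ℕ,
      (@FPn Aᵐᵒᵖ _ n ℂ _ (trivModOp A (Bialgebra.counitAlgHom ℂ A)))
      ↔ (@FPn (↥B)ᵐᵒᵖ _ n ℂ _ (trivModOp ↥B ((Bialgebra.counitAlgHom ℂ A).comp B.val))) := by
  intro n
  let := B.opModule
  let := trivModOp A (Bialgebra.counitAlgHom ℂ A)
  let := trivModOp ↥B ((Bialgebra.counitAlgHom ℂ A).comp B.val)
  have : IsScalarTower (↥B)ᵐᵒᵖ Aᵐᵒᵖ Aᵐᵒᵖ := ⟨fun b a c =>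
    mul_assoc (op (↑(unop b) : A)) a c⟩
  have : IsScalarTower (↥B)ᵐᵒᵖ Aᵐᵒᵖ ℂ := ⟨fun b a c =>
    mul_smul (op (↑(unop b) : A)) a c⟩
  have := hproj.finite_and_projective.1
  have := hproj.finite_and_projective.2
  exact FPn.restrictScalars_iff (↥B)ᵐᵒᵖ
end
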